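/- Let h(u,v) = \sum_{i=0}^{12} \binom{12}{i} \alpha_i u^i v^{12-i} with (\alpha_0, \dots, \alpha_{12}) = (55, 29, -7, -3, -9, -15, -81/7, 9, -9, -27, -135, -459, 567). Define g = (1/132^2)(h_{uu} h_{vv} - h_{uv}^2) and f = (1/240)(h_u g_v - h_v g_u), where subscripts denote partial derivatives with respect to u and v; then f is a binary form of degree 30 with integer coefficients. There are no integers u, v, y with (u, v) \neq (0, 0) and y^2 = f(u, v). -/

import Mathlib

open MvPolynomial

/-- The coefficient vector `(α₀, …, α₁₂)`. -/
noncomputable def alphaC15 : Fin 13 → ℚ := ![55, 29, -7, -3, -9, -15, -81/7, 9, -9, -27, -135, -459, 567]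

/-- The binary form `h(u,v) = ∑ i, (12 choose i) αᵢ uⁱ v^(12-i)`,
as a polynomial in the two variables `X 0 = u` and `X 1 = v`. -/
noncomputable def hC15 : MvPolynomial (Fin 2) ℚ :=
  ∑ i : Fin 13, C ((Nat.choose 12 i : ℚ) * alphaC15 i) * X 0 ^ (i : ℕ) * X 1 ^ (12 - (i : ℕ))

/-- `g = (1/132²)·(h_uu h_vv - h_uv²)`. -/
noncomputable def gC15 : MvPolynomial (Fin 2) ℚ :=
  C ((1 : ℚ) / 132 ^ 2) *
    (pderiv 0 (pderiv 0 hC15) * pderiv 1 (pderiv 1 hC15) -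
      pderiv 1 (pderiv 0 hC15) * pderiv 1 (pderiv 0 hC15))

/-- `f = (1/240)·(h_u g_v - h_v g_u)`. -/
noncomputable def fC15 : MvPolynomial (Fin 2) ℚ :=
  C ((1 : ℚ) / 240) *
    (pderiv 0 hC15 * pderiv 1 gC15 - pderiv 1 hC15 * pderiv 0 gC15)


section Field

open NumberField Module

/-- Integer coordinate vectors with respect to `1, θ, θ², ρ, ω`. -/
structure Z5 where
  (a b c d e : ℤ)
deriving DecidableEq

namespace Z5

/-- Multiplication in the basis `1, θ, θ², ρ, ω`. -/
def mul (x y : Z5) : Z5 where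
  a := x.a*y.a + 5*x.b*y.e + 10*x.c*y.d + 30*x.c*y.e + 10*x.d*y.c + 35*x.d*y.d + 140*x.d*y.e + 5*x.e*y.b + 30*x.e*y.c + 140*x.e*y.d + 555*x.e*y.e
  b := x.a*y.b + x.b*y.a - x.b*y.d + 2*x.b*y.e - 2*x.c*y.c + 4*x.c*y.d + 10*x.c*y.e - x.d*y.b + 4*x.d*y.c + 12*x.d*y.d + 47*x.d*y.e + 2*x.e*y.b + 10*x.e*y.c + 47*x.e*y.d + 187*x.e*y.e
  c := x.a*y.c + x.b*y.b - x.b*y.c + 2*x.b*y.e + x.c*y.a - x.c*y.b + x.c*y.c + 3*x.c*y.d + 12*x.c*y.e + 3*x.d*y.c + 14*x.d*y.d + 55*x.d*y.e + 2*x.e*y.b + 12*x.e*y.c + 55*x.e*y.d + 218*x.e*y.e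
  d := x.a*y.d + 2*x.b*y.c + 7*x.b*y.e + 2*x.c*y.b - 2*x.c*y.c + 14*x.c*y.d + 46*x.c*y.e + x.d*y.a + 14*x.d*y.c + 52*x.d*y.d + 210*x.d*y.e + 7*x.e*y.b + 46*x.e*y.c + 210*x.e*y.d + 832*x.e*y.e
  e := x.a*y.e + 2*x.b*y.d + 6*x.b*y.e + 4*x.c*y.c + 12*x.c*y.d + 50*x.c*y.e + 2*x.d*y.b + 12*x.d*y.c + 56*x.d*y.d + 221*x.d*y.e + x.e*y.a + 6*x.e*y.b + 50*x.e*y.c + 221*x.e*y.d + 876*x.e*y.e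

/-- Addition of coordinate vectors. -/
def add (x y : Z5) : Z5 := ⟨x.a + y.a, x.b + y.b, x.c + y.c, x.d + y.d, x.e + y.e⟩

/-- Scaling of coordinate vectors. -/
def smul (n : ℤ) (x : Z5) : Z5 := ⟨n * x.a, n * x.b, n * x.c, n * x.d, n * x.e⟩

/-- Evaluation at `θ = r`, where `t` is the inverse of two. -/
def ev {R : Type*} [CommRing R] (r t : R) (x : Z5) : R :=
  x.a + x.b * r + x.c * r ^ 2 + x.d * ((r ^ 3 + r ^ 2) * t) + x.e * ((r ^ 4 + r ^ 3 + 2 * r) * t ^ 2)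

theorem ev_add {R : Type*} [CommRing R] (r t : R) (x y : Z5) :
    ev r t (add x y) = ev r t x + ev r t y := by
  simp only [ev, add]; push_cast; ring

theorem ev_smul {R : Type*} [CommRing R] (r t : R) (n : ℤ) (x : Z5) :
    ev r t (smul n x) = n * ev r t x := by
  simp only [ev, smul]; push_cast; ring

theorem ev_mul {R : Type*} [CommRing R] (r t : R) (ht : 2 * t = 1)
    (hr : r ^ 5 = 5 * r ^ 4 + 20 * r ^ 3 + 20 * r ^ 2 + 20 * r + 20) (x y : Z5) :
    ev r t (mul x y) = ev r t x * ev r t y := by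
  obtain ⟨p, hp⟩ : ∃ p, p = (r ^ 3 + r ^ 2) * t := ⟨_, rfl⟩
  obtain ⟨q, hq⟩ : ∃ q, q = (r ^ 4 + r ^ 3 + 2 * r) * t ^ 2 := ⟨_, rfl⟩
  have hp2 : 2 * p = r ^ 3 + r ^ 2 := by linear_combination 2 * hp + (r ^ 3 + r ^ 2) * ht
  have hq2 : 4 * q = r ^ 4 + r ^ 3 + 2 * r := by
    linear_combination 4 * hq + (r ^ 4 + r ^ 3 + 2 * r) * (2 * t + 1) * ht
  have can : ∀ a b : R, 2 * a = 2 * b → a = b := fun a b h => by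
    linear_combination t * h - (a - b) * ht
  have e1 : r * r ^ 2 = 2 * p - r ^ 2 := by linear_combination -hp2
  have e2 : r * p = 2 * q - r := can _ _ (by linear_combination r * hp2 - hq2)
  have e3 : r * q = 5 + 2 * r + 2 * r ^ 2 + 7 * p + 6 * q :=
    can _ _ (can _ _ (by linear_combination r * hq2 - 14 * hp2 - 6 * hq2 + hr))
  have f1 : r ^ 2 * r ^ 2 = - 2 * r + r ^ 2 - 2 * p + 4 * q := by
    linear_combination r * e1 + 2 * e2 - e1
  have f2 : r ^ 2 * p = 10 + 4 * r + 3 * r ^ 2 + 14 * p + 12 * q := by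
    linear_combination r * e2 + 2 * e3
  have f3 : r ^ 2 * q = 30 + 10 * r + 12 * r ^ 2 + 46 * p + 50 * q := by
    linear_combination r * e3 + 2 * e1 + 7 * e2 + 6 * e3
  have g1 : p * p = 35 + 12 * r + 14 * r ^ 2 + 52 * p + 56 * q :=
    can _ _ (by linear_combination p * hp2 + r * f2 + 3 * e1 + 14 * e2 + 12 * e3 + f2)
  have g2 : p * q = 140 + 47 * r + 55 * r ^ 2 + 210 * p + 221 * q :=
    can _ _ (by linear_combination q * hp2 + r * f3 + 12 * e1 + 46 * e2 + 50 * e3 + f3)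
  have s3 : r ^ 3 * q = 250 + 84 * r + 98 * r ^ 2 + 374 * p + 392 * q := by
    linear_combination r * f3 + 12 * e1 + 46 * e2 + 50 * e3
  have g3 : q * q = 555 + 187 * r + 218 * r ^ 2 + 832 * p + 876 * q :=
    can _ _ (can _ _ (by
      linear_combination q * hq2 + r * s3 + 98 * e1 + 374 * e2 + 392 * e3 + s3 + 2 * e3))
  simp only [ev, mul, ← hp, ← hq]
  push_cast
  linear_combination (-(x.b * y.c + x.c * y.b : R)) * e1 + (-(x.b * y.d + x.d * y.b : R)) * e2
    + (-(x.b * y.e + x.e * y.b : R)) * e3 + (-(x.c * y.c : R)) * f1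
    + (-(x.c * y.d + x.d * y.c : R)) * f2 + (-(x.c * y.e + x.e * y.c : R)) * f3
    + (-(x.d * y.d : R)) * g1 + (-(x.d * y.e + x.e * y.d : R)) * g2 + (-(x.e * y.e : R)) * g3

end Z5

/-- The data of the quintic field: a power basis of dimension five whose generator is a root of
`x⁵ - 5x⁴ - 20x³ - 20x² - 20x - 20`. -/
structure Quint (K : Type*) [Field K] [NumberField K] where
  pb : PowerBasis ℚ K
  dim : pb.dim = 5
  rel : pb.gen ^ 5 = 5 * pb.gen ^ 4 + 20 * pb.gen ^ 3 + 20 * pb.gen ^ 2 + 20 * pb.gen + 20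

namespace Quint

variable {K : Type*} [Field K] [NumberField K] (Q : Quint K)

/-- The basis `1, θ, θ², θ³, θ⁴`. -/
noncomputable def bas : Basis (Fin 5) ℚ K := Q.pb.basis.reindex (finCongr Q.dim)

theorem bas_apply (i : Fin 5) : Q.bas i = Q.pb.gen ^ (i : ℕ) := by
  simp [bas]

theorem finrank_eq (Q : Quint K) : finrank ℚ K = 5 := by
  rw [Q.pb.finrank, Q.dim]

/-- Multiplication matrix of `∑ pᵢ θⁱ`. -/
def mulMat {R : Type*} [CommRing R] (p0 p1 p2 p3 p4 : R) : Matrix (Fin 5) (Fin 5) R :=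
  !![p0, 20*p4, 20*p3+100*p4, 20*p2+100*p3+900*p4, 20*p1+100*p2+900*p3+6900*p4;
     p1, p0+20*p4, 20*p3+120*p4, 20*p2+120*p3+1000*p4, 20*p1+120*p2+1000*p3+7800*p4;
     p2, p1+20*p4, p0+20*p3+120*p4, 20*p2+120*p3+1020*p4, 20*p1+120*p2+1020*p3+7900*p4;
     p3, p2+20*p4, p1+20*p3+120*p4, p0+20*p2+120*p3+1020*p4, 20*p1+120*p2+1020*p3+7920*p4;
     p4, p3+5*p4, p2+5*p3+45*p4, p1+5*p2+45*p3+345*p4, p0+5*p1+45*p2+345*p3+2745*p4]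

theorem leftMul (p0 p1 p2 p3 p4 : ℚ) :
    Algebra.leftMulMatrix Q.bas (p0 + p1 * Q.pb.gen + p2 * Q.pb.gen ^ 2 + p3 * Q.pb.gen ^ 3
      + p4 * Q.pb.gen ^ 4 : K) = mulMat p0 p1 p2 p3 p4 := by
  have hr := Q.rel
  set θ := Q.pb.gen with hθ
  have key : ∀ j : Fin 5, (p0 + p1 * θ + p2 * θ ^ 2 + p3 * θ ^ 3 + p4 * θ ^ 4 : K) * Q.bas j =
      ∑ i, mulMat p0 p1 p2 p3 p4 i j • Q.bas i := by
    intro j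
    simp only [Fin.sum_univ_five, bas_apply, ← hθ, Algebra.smul_def, eq_ratCast]
    fin_cases j
    · simp [mulMat]
    · simp [mulMat]; linear_combination (p4 : K) * hr
    · simp [mulMat]; linear_combination (p3 + p4 * θ + 5 * p4 : K) * hr
    · simp [mulMat]
      linear_combination (p2 + p3 * θ + p4 * θ ^ 2 + 5 * (p3 + p4 * θ) + 45 * p4 : K) * hr
    · simp [mulMat]
      linear_combination (p1 + p2 * θ + p3 * θ ^ 2 + p4 * θ ^ 3 + 5 * (p2 + p3 * θ + p4 * θ ^ 2)
        + 45 * (p3 + p4 * θ) + 345 * p4 : K) * hr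
  ext i j
  rw [Algebra.leftMulMatrix_eq_repr_mul, key j, Basis.repr_sum_self]

theorem trace_pow (p0 p1 p2 p3 p4 : ℚ) :
    Algebra.trace ℚ K (p0 + p1 * Q.pb.gen + p2 * Q.pb.gen ^ 2 + p3 * Q.pb.gen ^ 3
      + p4 * Q.pb.gen ^ 4 : K) = 5 * p0 + 5 * p1 + 65 * p2 + 485 * p3 + 3905 * p4 := by
  rw [Algebra.trace_eq_matrix_trace Q.bas, leftMul]
  simp [Matrix.trace, mulMat, Fin.sum_univ_five]
  ring

/-- Three by three minors. -/
def det3 {R : Type*} [CommRing R] (M : Matrix (Fin 5) (Fin 5) R) (i j k : Fin 5) : R :=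
  M i 2 * (M j 3 * M k 4 - M j 4 * M k 3) - M i 3 * (M j 2 * M k 4 - M j 4 * M k 2)
    + M i 4 * (M j 2 * M k 3 - M j 3 * M k 2)

/-- Laplace expansion of a five by five determinant along the first two columns. -/
def det5 {R : Type*} [CommRing R] (M : Matrix (Fin 5) (Fin 5) R) : R :=
  (M 0 0 * M 1 1 - M 0 1 * M 1 0) * det3 M 2 3 4 - (M 0 0 * M 2 1 - M 0 1 * M 2 0) * det3 M 1 3 4
  + (M 0 0 * M 3 1 - M 0 1 * M 3 0) * det3 M 1 2 4 - (M 0 0 * M 4 1 - M 0 1 * M 4 0) * det3 M 1 2 3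
  + (M 1 0 * M 2 1 - M 1 1 * M 2 0) * det3 M 0 3 4 - (M 1 0 * M 3 1 - M 1 1 * M 3 0) * det3 M 0 2 4
  + (M 1 0 * M 4 1 - M 1 1 * M 4 0) * det3 M 0 2 3 + (M 2 0 * M 3 1 - M 2 1 * M 3 0) * det3 M 0 1 4
  - (M 2 0 * M 4 1 - M 2 1 * M 4 0) * det3 M 0 1 3 + (M 3 0 * M 4 1 - M 3 1 * M 4 0) * det3 M 0 1 2

theorem det_eq_det5 {R : Type*} [CommRing R] (M : Matrix (Fin 5) (Fin 5) R) : M.det = det5 M := by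
  rw [Matrix.det_succ_row_zero]
  simp [Fin.sum_univ_succ, Matrix.det_succ_row_zero, Fin.succAbove, det5, det3]
  ring

end Quint

/-- `1024` times the norm of an element of the order. -/
def Z5.nrm (x : Z5) : ℤ :=
  Quint.det5 (Quint.mulMat (4 * x.a) (4 * x.b + 2 * x.e) (4 * x.c + 2 * x.d) (2 * x.d + x.e) x.e)

namespace Quint

variable {K : Type*} [Field K] [NumberField K] (Q : Quint K)

/-- The element of `K` with given coordinates. -/
noncomputable def elK (x : Z5) : K := Z5.ev Q.pb.gen (2⁻¹ : K) x

theorem norm_elK (x : Z5) : 1024 * Algebra.norm ℚ (Q.elK x) = x.nrm := by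
  have h4 : (4 : K) * Q.elK x = (((4 * x.a : ℤ) : ℚ) : K) + ((4 * x.b + 2 * x.e : ℤ) : ℚ) * Q.pb.gen
      + ((4 * x.c + 2 * x.d : ℤ) : ℚ) * Q.pb.gen ^ 2 + ((2 * x.d + x.e : ℤ) : ℚ) * Q.pb.gen ^ 3
      + ((x.e : ℤ) : ℚ) * Q.pb.gen ^ 4 := by
    simp only [elK, Z5.ev]; push_cast; field_simp; ring
  have h5 : Algebra.norm ℚ ((4 : K) * Q.elK x) = 1024 * Algebra.norm ℚ (Q.elK x) := by
    rw [map_mul]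
    have : (4 : K) = algebraMap ℚ K 4 := by simp
    rw [this, Algebra.norm_algebraMap, Q.finrank_eq]; norm_num
  rw [← h5, h4, Algebra.norm_eq_matrix_det Q.bas, leftMul, det_eq_det5, Z5.nrm]
  simp [det5, det3, mulMat]

theorem elK_inj (x y : Z5) (h : Q.elK x = Q.elK y) : x = y := by
  have h4 : ∀ x : Z5, (4 : K) * Q.elK x = ∑ i, (![4 * x.a, 4 * x.b + 2 * x.e, 4 * x.c + 2 * x.d,
      2 * x.d + x.e, x.e] i : ℚ) • Q.bas i := by
    intro x
    simp only [Fin.sum_univ_five, bas_apply, Algebra.smul_def, eq_ratCast]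
    simp [elK, Z5.ev]; field_simp; ring
  have h1 := h4 x
  rw [h, h4 y] at h1
  have h2 := congrArg (fun t => Q.bas.equivFun t) h1
  simp only [Basis.equivFun_apply, Basis.repr_sum_self] at h2
  have e0 : 4 * y.a = 4 * x.a := Int.cast_injective (congrFun h2 0)
  have e1 : 4 * y.b + 2 * y.e = 4 * x.b + 2 * x.e := Int.cast_injective (congrFun h2 1)
  have e2 : 4 * y.c + 2 * y.d = 4 * x.c + 2 * x.d := Int.cast_injective (congrFun h2 2)
  have e3 : 2 * y.d + y.e = 2 * x.d + x.e := Int.cast_injective (congrFun h2 3)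
  have e4 : y.e = x.e := Int.cast_injective (congrFun h2 4)
  cases x; cases y
  simp only [Z5.mk.injEq] at *
  omega

theorem elK_mul (x y : Z5) : Q.elK (x.mul y) = Q.elK x * Q.elK y :=
  Z5.ev_mul _ _ (by norm_num) Q.rel x y

theorem elK_add (x y : Z5) : Q.elK (x.add y) = Q.elK x + Q.elK y := Z5.ev_add _ _ x y

theorem elK_smul (n : ℤ) (x : Z5) : Q.elK (x.smul n) = n * Q.elK x := Z5.ev_smul _ _ n x

theorem int_gen : IsIntegral ℤ Q.pb.gen := by
  refine ⟨Polynomial.X ^ 5 - (Polynomial.C 5 * Polynomial.X ^ 4 + Polynomial.C 20 * Polynomial.X ^ 3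
    + Polynomial.C 20 * Polynomial.X ^ 2 + Polynomial.C 20 * Polynomial.X + Polynomial.C 20), ?_, ?_⟩
  · apply Polynomial.monic_X_pow_sub
    compute_degree!
  · simp only [← Polynomial.aeval_def, map_sub, map_add, map_mul, map_pow, Polynomial.aeval_X,
      Polynomial.aeval_C]
    simp [Q.rel]

theorem int_rho : IsIntegral ℤ (Q.elK ⟨0, 0, 0, 1, 0⟩) := by
  refine ⟨Polynomial.X ^ 5 - (Polynomial.C 275 * Polynomial.X ^ 4 + Polynomial.C 710 * Polynomial.X ^ 3
    + Polynomial.C 750 * Polynomial.X ^ 2 + Polynomial.C 375 * Polynomial.X + Polynomial.C 75), ?_, ?_⟩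
  · apply Polynomial.monic_X_pow_sub
    compute_degree!
  · simp only [← Polynomial.aeval_def, map_sub, map_add, map_mul, map_pow, Polynomial.aeval_X,
      Polynomial.aeval_C]
    have h2 : Q.elK ⟨0, 0, 0, 1, 0⟩ ^ 2 = Q.elK ⟨35, 12, 14, 52, 56⟩ := by
      rw [pow_two, ← elK_mul]; rfl
    have h3 : Q.elK ⟨0, 0, 0, 1, 0⟩ ^ 3 = Q.elK (Z5.mul ⟨35, 12, 14, 52, 56⟩ ⟨0, 0, 0, 1, 0⟩) := by
      rw [pow_succ, h2, ← elK_mul]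
    have h4 : Q.elK ⟨0, 0, 0, 1, 0⟩ ^ 4 = Q.elK (Z5.mul ⟨35, 12, 14, 52, 56⟩ ⟨35, 12, 14, 52, 56⟩) := by
      rw [elK_mul, ← h2]; ring
    have h5 : Q.elK ⟨0, 0, 0, 1, 0⟩ ^ 5 = Q.elK (Z5.mul (Z5.mul ⟨35, 12, 14, 52, 56⟩
        ⟨35, 12, 14, 52, 56⟩) ⟨0, 0, 0, 1, 0⟩) := by
      rw [pow_succ, h4, ← elK_mul]
    rw [h5, h4, h3, h2]
    simp only [elK, Z5.ev, Z5.mul]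
    norm_num
    ring

theorem int_omega : IsIntegral ℤ (Q.elK ⟨0, 0, 0, 0, 1⟩) := by
  refine ⟨Polynomial.X ^ 5 - (Polynomial.C 1100 * Polynomial.X ^ 4 + Polynomial.C 140 * Polynomial.X ^ 3
    + Polynomial.C (-110) * Polynomial.X ^ 2 + Polynomial.C (-5) * Polynomial.X + Polynomial.C 10), ?_, ?_⟩
  · apply Polynomial.monic_X_pow_sub
    compute_degree!
  · simp only [← Polynomial.aeval_def, map_sub, map_add, map_mul, map_pow, Polynomial.aeval_X,
      Polynomial.aeval_C]
    have h2 : Q.elK ⟨0, 0, 0, 0, 1⟩ ^ 2 = Q.elK ⟨555, 187, 218, 832, 876⟩ := by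
      rw [pow_two, ← elK_mul]; rfl
    have h3 : Q.elK ⟨0, 0, 0, 0, 1⟩ ^ 3 = Q.elK (Z5.mul ⟨555, 187, 218, 832, 876⟩ ⟨0, 0, 0, 0, 1⟩) := by
      rw [pow_succ, h2, ← elK_mul]
    have h4 : Q.elK ⟨0, 0, 0, 0, 1⟩ ^ 4 = Q.elK (Z5.mul ⟨555, 187, 218, 832, 876⟩
        ⟨555, 187, 218, 832, 876⟩) := by
      rw [elK_mul, ← h2]; ring
    have h5 : Q.elK ⟨0, 0, 0, 0, 1⟩ ^ 5 = Q.elK (Z5.mul (Z5.mul ⟨555, 187, 218, 832, 876⟩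
        ⟨555, 187, 218, 832, 876⟩) ⟨0, 0, 0, 0, 1⟩) := by
      rw [pow_succ, h4, ← elK_mul]
    rw [h5, h4, h3, h2]
    simp only [elK, Z5.ev, Z5.mul]
    norm_num
    ring

theorem int_elK (x : Z5) : IsIntegral ℤ (Q.elK x) := by
  have e : Q.elK x = x.a + x.b * Q.pb.gen + x.c * Q.pb.gen ^ 2 + x.d * Q.elK ⟨0, 0, 0, 1, 0⟩
      + x.e * Q.elK ⟨0, 0, 0, 0, 1⟩ := by
    simp [elK, Z5.ev]
  rw [e]
  have hi : ∀ n : ℤ, IsIntegral ℤ (n : K) := fun n => by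
    simpa using (isIntegral_algebraMap (R := ℤ) (A := K) (x := n))
  exact ((((hi _).add ((hi _).mul Q.int_gen)).add ((hi _).mul (Q.int_gen.pow 2))).add
    ((hi _).mul Q.int_rho)).add ((hi _).mul Q.int_omega)

/-- The algebraic integer with given coordinates. -/
noncomputable def el (x : Z5) : 𝓞 K := ⟨Q.elK x, Q.int_elK x⟩

theorem coe_el (x : Z5) : ((Q.el x : 𝓞 K) : K) = Q.elK x := rfl

theorem el_mul (x y : Z5) : Q.el (x.mul y) = Q.el x * Q.el y :=
  RingOfIntegers.ext (by simpa [coe_el] using Q.elK_mul x y)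

theorem el_add (x y : Z5) : Q.el (x.add y) = Q.el x + Q.el y :=
  RingOfIntegers.ext (by simpa [coe_el] using Q.elK_add x y)

theorem el_smul (n : ℤ) (x : Z5) : Q.el (x.smul n) = n * Q.el x :=
  RingOfIntegers.ext (by simpa [coe_el] using Q.elK_smul n x)

theorem el_int (n : ℤ) : Q.el ⟨n, 0, 0, 0, 0⟩ = n :=
  RingOfIntegers.ext (by simp [coe_el, elK, Z5.ev])

theorem el_inj (x y : Z5) (h : Q.el x = Q.el y) : x = y :=
  Q.elK_inj x y (by rw [← coe_el, h, coe_el])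

theorem norm_el (x : Z5) : 1024 * Algebra.norm ℤ (Q.el x) = x.nrm := by
  have := Q.norm_elK x
  rw [← coe_el, ← Algebra.coe_norm_int] at this
  exact_mod_cast this

end Quint

/-- The trace in coordinates. -/
def Z5.tr (x : Z5) : ℤ := 5 * x.a + 5 * x.b + 65 * x.c + 275 * x.d + 1100 * x.e

/-- The coordinate vectors of the basis. -/
def Z5.std (i : Fin 5) : Z5 := ![⟨1, 0, 0, 0, 0⟩, ⟨0, 1, 0, 0, 0⟩, ⟨0, 0, 1, 0, 0⟩, ⟨0, 0, 0, 1, 0⟩,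
  ⟨0, 0, 0, 0, 1⟩] i

/-- The integral trace form. -/
def Z5.trMat : Matrix (Fin 5) (Fin 5) ℤ := fun i j => ((Z5.std i).mul (Z5.std j)).tr

theorem Z5.trMat_det : Z5.trMat.det = 16200000 := by
  rw [Quint.det_eq_det5]; decide

namespace Quint

variable {K : Type*} [Field K] [NumberField K] (Q : Quint K)

theorem trace_elK (x : Z5) : Algebra.trace ℚ K (Q.elK x) = x.tr := by
  have h := Q.trace_pow x.a (x.b + x.e / 2) (x.c + x.d / 2) (x.d / 2 + x.e / 4) (x.e / 4)
  have e : Q.elK x = ((x.a : ℚ) : K) + ((x.b + x.e / 2 : ℚ) : K) * Q.pb.gen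
      + ((x.c + x.d / 2 : ℚ) : K) * Q.pb.gen ^ 2 + ((x.d / 2 + x.e / 4 : ℚ) : K) * Q.pb.gen ^ 3
      + ((x.e / 4 : ℚ) : K) * Q.pb.gen ^ 4 := by
    simp only [elK, Z5.ev]; push_cast; field_simp; ring
  rw [e, h, Z5.tr]; push_cast; ring

/-- The integral basis as a family in `K`. -/
noncomputable def vf (i : Fin 5) : K := Q.elK (Z5.std i)

theorem traceMatrix_vf : Algebra.traceMatrix ℚ Q.vf = Z5.trMat.map (Int.castRingHom ℚ) := by
  ext i j
  rw [Algebra.traceMatrix_apply, Algebra.traceForm_apply, vf, vf, ← elK_mul, trace_elK]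
  simp [Z5.trMat]

theorem discr_vf : Algebra.discr ℚ Q.vf = 16200000 := by
  have := Z5.trMat_det
  rw [Algebra.discr_def, traceMatrix_vf, ← RingHom.mapMatrix_apply, ← RingHom.map_det, this]
  simp

theorem li_vf : LinearIndependent ℚ Q.vf := by
  by_contra h
  have := Algebra.discr_zero_of_not_linearIndependent ℚ h
  rw [discr_vf] at this
  norm_num at this

/-- The integral basis as a rational basis of `K`. -/
noncomputable def bO : Basis (Fin 5) ℚ K :=
  basisOfLinearIndependentOfCardEqFinrank Q.li_vf (by simp [Q.finrank_eq])

theorem bO_coe : ⇑Q.bO = Q.vf := by simp [bO]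

theorem elK_eq_sum (x : Z5) : Q.elK x = ∑ i, ((![x.a, x.b, x.c, x.d, x.e] i : ℤ) : ℚ) • Q.vf i := by
  simp only [Fin.sum_univ_five, Algebra.smul_def, eq_ratCast]
  simp [vf, Z5.std, elK, Z5.ev]

theorem span_el (z : 𝓞 K) : ∃ y : Z5, 16200000 * z = Q.el y := by
  set c : Fin 5 → ℚ := fun i => Q.bO.repr (z : K) i
  have hz : (z : K) = ∑ i, c i • Q.vf i := by
    rw [← Q.bO.sum_repr (z : K), bO_coe]
  have ht : ∀ i, ∃ t : ℤ, Algebra.trace ℚ K (Q.vf i * z) = t := by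
    intro i
    refine ⟨Algebra.trace ℤ (𝓞 K) (Q.el (Z5.std i) * z), ?_⟩
    rw [Algebra.coe_trace_int]; rfl
  choose t ht using ht
  have h1 : (Z5.trMat.map (Int.castRingHom ℚ)).mulVec c = fun i => (t i : ℚ) := by
    ext i
    rw [← ht i, hz, ← Q.traceMatrix_vf, Finset.mul_sum, map_sum]
    simp only [Matrix.mulVec, dotProduct, Algebra.traceMatrix_apply, Algebra.traceForm_apply,
      mul_smul_comm, map_smul, smul_eq_mul]
    exact Finset.sum_congr rfl fun j _ => mul_comm _ _
  have h2 : (16200000 : ℚ) • c = fun i => ((Z5.trMat.adjugate.mulVec t i : ℤ) : ℚ) := by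
    have h3 : (Z5.trMat.map (Int.castRingHom ℚ)).adjugate.mulVec
      ((Z5.trMat.map (Int.castRingHom ℚ)).mulVec c) = (16200000 : ℚ) • c := by
      rw [Matrix.mulVec_mulVec, Matrix.adjugate_mul, ← Q.traceMatrix_vf, ← Algebra.discr_def, discr_vf,
        Matrix.smul_mulVec, Matrix.one_mulVec]
    rw [← h3, h1, ← RingHom.mapMatrix_apply, ← RingHom.map_adjugate]
    ext i
    simp [Matrix.mulVec, dotProduct]
  set s := Z5.trMat.adjugate.mulVec t
  refine ⟨⟨s 0, s 1, s 2, s 3, s 4⟩, RingOfIntegers.ext ?_⟩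
  rw [coe_el, elK_eq_sum]
  have h6 : ((16200000 * z : 𝓞 K) : K) = 16200000 * (z : K) := by
    change algebraMap (𝓞 K) K (16200000 * z) = 16200000 * algebraMap (𝓞 K) K z
    rw [map_mul, map_ofNat]
  rw [h6, hz, Finset.mul_sum]
  refine Finset.sum_congr rfl fun i _ => ?_
  have h4 := congrFun h2 i
  have h5 : ![s 0, s 1, s 2, s 3, s 4] i = s i := by fin_cases i <;> rfl
  rw [h5, ← h4, Pi.smul_apply, smul_eq_mul, mul_smul]
  simp [Algebra.smul_def]

theorem discr_le (Q : Quint K) : |discr K| ≤ 16200000 := by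
  have hcard : Fintype.card (Free.ChooseBasisIndex ℤ (𝓞 K)) = Fintype.card (Fin 5) := by
    rw [← finrank_eq_card_chooseBasisIndex, RingOfIntegers.rank, Q.finrank_eq]; simp
  let e := Fintype.equivOfCardEq hcard
  let b := (integralBasis K).reindex e
  have hb : Algebra.discr ℚ b = discr K := by
    rw [coe_discr, Basis.coe_reindex, ← Algebra.discr_reindex ℚ (integralBasis K) e]
  let P : Matrix (Fin 5) (Fin 5) ℤ := fun i j => (RingOfIntegers.basis K).repr (Q.el (Z5.std j)) (e.symm i)
  have hv : Q.vf = Matrix.vecMul b (P.map (algebraMap ℤ K)) := by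
    ext j
    have h1 := b.sum_repr (Q.vf j)
    rw [← h1]
    simp only [Matrix.vecMul, dotProduct]
    refine Finset.sum_congr rfl fun i _ => ?_
    have : b.repr (Q.vf j) i = P i j := by
      have := integralBasis_repr_apply K (Q.el (Z5.std j)) (e.symm i)
      simp only [b, Basis.repr_reindex, P]
      rw [Finsupp.mapDomain_equiv_apply]
      exact this
    rw [this, Algebra.smul_def, mul_comm]
    simp
  have h2 : Algebra.discr ℚ Q.vf = (P.det : ℚ) ^ 2 * discr K := by
    rw [hv, ← hb]
    have := Algebra.discr_of_matrix_vecMul (A := ℚ) (B := K) b (P.map (algebraMap ℤ ℚ))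
    rw [show (P.map (algebraMap ℤ ℚ)).det = P.det from by
      rw [← RingHom.mapMatrix_apply, ← RingHom.map_det]; simp] at this
    rw [← this, Matrix.map_map]
    congr 2
    ext i j
    simp
  rw [discr_vf] at h2
  have h3 : (16200000 : ℤ) = P.det ^ 2 * discr K := by exact_mod_cast h2
  have h4 : |discr K| ∣ 16200000 := by
    rw [h3, abs_dvd]; exact dvd_mul_left _ _
  exact Int.le_of_dvd (by norm_num) h4

end Quint

/-- Generators of the five primes above `2, 3, 5`. -/
def piS (i : Fin 5) : Z5 := ![⟨2, 1, 1, 3, 3⟩, ⟨53, 26, 11, 60, -16⟩, ⟨478, 229, 123, 519, -140⟩,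
  ⟨-3, 17, 15, 12, -4⟩, ⟨0, 4, 3, 2, -1⟩] i

/-- The rational primes below `piS`. -/
def chS (i : Fin 5) : ℤ := ![2, -2, 3, -3, -5] i

theorem piS_nrm (i : Fin 5) : (piS i).nrm = 1024 * chS i := by
  revert i; decide +kernel

theorem chS_prime (i : Fin 5) : (chS i).natAbs.Prime := by
  fin_cases i <;> simp [chS] <;> norm_num

namespace Quint

variable {K : Type*} [Field K] [NumberField K] (Q : Quint K)

theorem norm_val (x : Z5) (n : ℤ) (h : x.nrm = 1024 * n) : Algebra.norm ℤ (Q.el x) = n := by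
  have := Q.norm_el x
  omega

/-- The prime elements above `2, 3, 5`. -/
noncomputable def pS (i : Fin 5) : 𝓞 K := Q.el (piS i)

theorem absNorm_pS (i : Fin 5) : Ideal.absNorm (Ideal.span {Q.pS i}) = (chS i).natAbs := by
  rw [Ideal.absNorm_span_singleton, pS, Q.norm_val _ _ (piS_nrm i)]

theorem pS_ne (i : Fin 5) : Q.pS i ≠ 0 := by
  intro h
  have := Q.absNorm_pS i
  rw [h] at this
  have h2 := (chS_prime i).ne_zero
  simp at this
  omega

theorem pS_prime (i : Fin 5) : Prime (Q.pS i) := by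
  apply Ideal.prime_of_irreducible_absNorm_span (Q.pS_ne i)
  rw [absNorm_pS]
  exact (chS_prime i)

theorem eq_span_pS (P : Ideal (𝓞 K)) [hP : P.IsPrime] (i : Fin 5) (h : Q.pS i ∈ P) :
    P = Ideal.span {Q.pS i} := by
  have h1 : (Ideal.span {Q.pS i}).IsPrime := (Ideal.span_singleton_prime (Q.pS_ne i)).2 (Q.pS_prime i)
  have h2 : (Ideal.span {Q.pS i}).IsMaximal := h1.isMaximal (by simpa using Q.pS_ne i)
  exact (h2.eq_of_le hP.ne_top (by simpa using h)).symm

theorem two_mul (Q : Quint K) : (2 : 𝓞 K) ∣ Q.pS 1 * (Q.pS 0 * Q.pS 0 * (Q.pS 0 * Q.pS 0)) := by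
  refine ⟨Q.el ⟨-241650512136, -81378598885, -94942872351, -362351588927, -381733138262⟩, ?_⟩
  have : (2 : 𝓞 K) = Q.el ⟨2, 0, 0, 0, 0⟩ := by rw [el_int]; norm_cast
  rw [this]
  simp only [pS, ← el_mul]
  congr 1

theorem three_mul (Q : Quint K) : (3 : 𝓞 K) ∣ Q.pS 2 * Q.pS 2 * (Q.pS 3 * Q.pS 3 * Q.pS 3) := by
  refine ⟨Q.el ⟨739869, 107485, -356859, -502628, 145608⟩, ?_⟩
  have : (3 : 𝓞 K) = Q.el ⟨3, 0, 0, 0, 0⟩ := by rw [el_int]; norm_cast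
  rw [this]
  simp only [pS, ← el_mul]
  congr 1

theorem five_mul (Q : Quint K) : (5 : 𝓞 K) ∣ Q.pS 4 * Q.pS 4 * (Q.pS 4 * Q.pS 4 * Q.pS 4) := by
  refine ⟨Q.el ⟨-338704576, -114063258, -133075399, -507883654, -535048811⟩, ?_⟩
  have : (5 : 𝓞 K) = Q.el ⟨5, 0, 0, 0, 0⟩ := by rw [el_int]; norm_cast
  rw [this]
  simp only [pS, ← el_mul]
  congr 1

theorem prime_over_S (P : Ideal (𝓞 K)) [hP : P.IsPrime]
    (h : (2 : 𝓞 K) ∈ P ∨ (3 : 𝓞 K) ∈ P ∨ (5 : 𝓞 K) ∈ P) : ∃ i, P = Ideal.span {Q.pS i} := by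
  have : ∃ i, Q.pS i ∈ P := by
    rcases h with h | h | h
    · have := P.mem_of_dvd Q.two_mul h
      simp only [hP.mul_mem_iff_mem_or_mem, or_self] at this
      tauto
    · have := P.mem_of_dvd Q.three_mul h
      simp only [hP.mul_mem_iff_mem_or_mem, or_self] at this
      tauto
    · have := P.mem_of_dvd Q.five_mul h
      simp only [hP.mul_mem_iff_mem_or_mem, or_self] at this
      exact ⟨4, this⟩
  obtain ⟨i, hi⟩ := this
  exact ⟨i, Q.eq_span_pS P i hi⟩

theorem prime_dvd_S (p : 𝓞 K) (hp : Prime p) (h : p ∣ 30) : ∃ i, Associated p (Q.pS i) := by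
  have h30 : (30 : 𝓞 K) = 2 * (3 * 5) := by norm_num
  have hI : (Ideal.span {p}).IsPrime := (Ideal.span_singleton_prime hp.ne_zero).2 hp
  obtain ⟨i, hi⟩ := Q.prime_over_S (Ideal.span {p}) (by
    simp only [Ideal.mem_span_singleton]
    rw [h30] at h
    rcases hp.dvd_or_dvd h with h | h
    · exact Or.inl h
    · exact Or.inr (hp.dvd_or_dvd h))
  exact ⟨i, Ideal.span_singleton_eq_span_singleton.1 hi⟩

theorem princ_of_mem (P : Ideal (𝓞 K)) (γ : 𝓞 K) (hγ : γ ≠ 0) (hP : γ ∈ P) (n : ℕ)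
    (hn : Ideal.absNorm P * n = (Algebra.norm ℤ γ).natAbs)
    (hR : ∀ R : Ideal (𝓞 K), R.IsPrime → R ≠ ⊥ → Ideal.absNorm R ∣ n → R.IsPrincipal) :
    P.IsPrincipal := by
  obtain ⟨J, hJ⟩ := Ideal.dvd_iff_le.2 ((Ideal.span_singleton_le_iff_mem P).2 hP)
  have hJ0 : J ≠ 0 := by
    rintro rfl
    simp at hJ
    exact hγ hJ
  have hP0 : P ≠ 0 := by
    rintro rfl
    simp at hJ
    exact hγ hJ
  have hJn : Ideal.absNorm J = n := by
    have := congrArg Ideal.absNorm hJ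
    rw [Ideal.absNorm_span_singleton, map_mul, ← hn] at this
    refine (Nat.eq_of_mul_eq_mul_left ?_ this).symm
    rw [Nat.pos_iff_ne_zero]
    intro h
    exact hP0 (by simpa using Ideal.absNorm_eq_zero_iff.1 h)
  have hJp : J.IsPrincipal := by
    rw [← Ideal.mem_isPrincipalSubmonoid_iff, ← Ideal.prod_normalizedFactors_eq_self hJ0]
    refine Submonoid.multiset_prod_mem _ _ fun R hR' => Ideal.mem_isPrincipalSubmonoid_iff.mp ?_
    obtain ⟨h1, h2⟩ := (UniqueFactorizationMonoid.mem_normalizedFactors_iff' hJ0).1 hR'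
    have h3 : Prime R := h1.prime
    refine hR R (Ideal.isPrime_of_prime h3) h3.ne_zero ?_
    rw [← hJn]
    exact Ideal.absNorm_dvd_absNorm_of_le (Ideal.le_of_dvd h2.2)
  obtain ⟨j, hj⟩ := hJp
  rw [Ideal.submodule_span_eq] at hj
  have : γ ∈ J := by
    rw [← Ideal.span_singleton_le_iff_mem, hJ]; exact Ideal.le_of_dvd (dvd_mul_left J P)
  rw [hj, Ideal.mem_span_singleton] at this
  obtain ⟨t, rfl⟩ := this
  refine ⟨t, ?_⟩
  rw [Ideal.submodule_span_eq]
  rw [← Ideal.span_singleton_mul_span_singleton, ← hj, mul_comm P] at hJ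
  exact (mul_left_cancel₀ hJ0 hJ).symm

end Quint

/-- `(p, r, a, b, c)`: a root `r` of the quintic modulo `p` and an element `a + bθ + cθ²` of the
corresponding prime of norm `p` whose norm has no other large prime factors. -/
def tabE : List (ℕ × ℕ × ℤ × ℤ × ℤ) :=
  [(7,1,-1,1,0),(13,3,-1,-1,-1),(13,5,-3,-2,0),(13,7,-5,-3,0),(23,9,-3,-1,1),(29,2,-2,1,0),
  (29,23,-1,1,1),(31,16,-5,-5,-1),(31,28,-3,-1,0),(37,3,-3,1,0),(41,7,-7,1,0),(43,11,-12,-6,1),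
  (59,34,-1,-1,1),(59,46,-11,-6,1),(73,38,-7,-6,-1),(79,41,-3,2,0),(107,9,-9,1,0),
  (107,61,-7,-3,1),(107,103,-4,-1,0),(109,46,-1,1,-1),(109,62,-3,-3,-1),(113,30,-1,-4,-2),
  (113,66,-4,1,-1),(113,75,-1,-3,0),(127,73,-11,-5,1),(131,16,-4,1,2),(131,84,-1,2,2),
  (137,68,-1,-2,0),(139,54,-8,-5,0),(139,134,-5,-1,0),(149,68,-5,0,1),(149,93,-2,3,3),
  (163,4,-4,1,0),(167,124,-5,-4,0),(173,81,-9,-4,1),(179,35,-11,-4,1),(181,46,-7,-5,-1),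
  (191,73,-7,-2,2),(191,178,-4,-2,1),(197,55,-2,-1,-2),(197,103,-7,-1,3),(197,109,-1,5,4),
  (199,27,-10,-7,0),(199,85,-5,-3,1),(211,53,-12,-5,1),(211,132,-9,-7,-1),(223,32,-4,-4,1),
  (227,11,-4,-1,2),(229,77,-2,3,0),(229,98,-11,-12,-3),(233,198,-12,-7,0),(251,175,-3,0,1)]

/-- The product of `30^20` and of the numbers in `[7, q)` coprime to `2, 3, 5, 7, 11, 13`, and of
`7`, `11`, `13` when below `q`. -/
def smo (q : ℕ) : ℕ := 30 ^ 20 * (((List.range q).filter fun n =>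
  n = 7 ∨ n = 11 ∨ n = 13 ∨ (1 < n ∧ Nat.gcd n 30030 = 1)).prod)

/-- Boolean check that a root modulo `p` is in the table. -/
def rootOK (p r : ℕ) : Bool :=
  decide (p < 7) || !(decide (p = 7 ∨ p = 11 ∨ p = 13 ∨ Nat.gcd p 30030 = 1)) ||
  !(decide (r ^ 5 % p = (5 * r ^ 4 + 20 * r ^ 3 + 20 * r ^ 2 + 20 * r + 20) % p)) ||
    (tabE.any fun x => decide (x.1 = p) && decide (x.2.1 = r))

theorem tab_root : ∀ p < 251, ∀ r < p, rootOK p r = true := by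
  decide +kernel

theorem tab_norm : ∀ x ∈ tabE, ((x.2.2.1 + x.2.2.2.1 * x.2.1 + x.2.2.2.2 * x.2.1 ^ 2 : ℤ) % x.1 = 0) ∧
    Z5.nrm ⟨x.2.2.1, x.2.2.2.1, x.2.2.2.2, 0, 0⟩ =
      1024 * (Z5.nrm ⟨x.2.2.1, x.2.2.2.1, x.2.2.2.2, 0, 0⟩ / 1024) ∧
    Z5.nrm ⟨x.2.2.1, x.2.2.2.1, x.2.2.2.2, 0, 0⟩ ≠ 0 ∧
    (Z5.nrm ⟨x.2.2.1, x.2.2.2.1, x.2.2.2.2, 0, 0⟩ / 1024).natAbs =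
      x.1 * ((Z5.nrm ⟨x.2.2.1, x.2.2.2.1, x.2.2.2.2, 0, 0⟩ / 1024).natAbs / x.1) ∧
    ((Z5.nrm ⟨x.2.2.1, x.2.2.2.1, x.2.2.2.2, 0, 0⟩ / 1024).natAbs / x.1) ∣ smo x.1 := by
  decide +kernel

theorem smo_dvd : ∀ q < 252, smo q ∣ smo 252 := by decide +kernel

theorem smo_sq : ∀ n < 252, 7 ≤ n → ¬ n * n ∣ smo 252 ∨ Nat.gcd n 30 ≠ 1 := by decide +kernel

theorem smo_mem : ∀ n < 252, n = 7 ∨ n = 11 ∨ n = 13 ∨ (1 < n ∧ Nat.gcd n 30030 = 1) → n.Prime := by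
  decide +kernel

theorem prime_dvd_smo (p q : ℕ) (hp : p.Prime) (h7 : 7 ≤ p) (hq : q < 252) (h : p ∣ smo q) : p < q := by
  unfold smo at h
  rcases (Nat.Prime.dvd_mul hp).1 h with h | h
  · have h1 := hp.dvd_of_dvd_pow h
    rw [show 30 = 2 * (3 * 5) by norm_num, Nat.Prime.dvd_mul hp, Nat.Prime.dvd_mul hp] at h1
    rcases h1 with h | h | h <;> have := Nat.le_of_dvd (by norm_num) h <;> omega
  · obtain ⟨n, hn, h⟩ := (hp.prime.dvd_prod_iff).1 h
    simp only [List.mem_filter, List.mem_range, decide_eq_true_eq] at hn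
    have hn' := smo_mem n (by omega) hn.2
    rw [(Nat.prime_dvd_prime_iff_eq hp hn').1 h]
    exact hn.1

theorem prime_pow_dvd_smo (p q k : ℕ) (hp : p.Prime) (h7 : 7 ≤ p) (hq : q < 252) (hk : 0 < k)
    (h : p ^ k ∣ smo q) : k = 1 ∧ p < q := by
  have h1 : p < q := prime_dvd_smo p q hp h7 hq ((dvd_pow_self p hk.ne').trans h)
  refine ⟨?_, h1⟩
  by_contra hk1
  have h2 : p * p ∣ smo 252 := by
    rw [← pow_two]
    exact ((pow_dvd_pow p (by omega)).trans h).trans (smo_dvd q hq)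
  rcases smo_sq p (by omega) h7 with h3 | h3
  · exact h3 h2
  · apply h3
    have : Nat.Coprime p 30 := by
      rw [Nat.Prime.coprime_iff_not_dvd hp]
      intro h1
      rw [show 30 = 2 * (3 * 5) by norm_num, Nat.Prime.dvd_mul hp, Nat.Prime.dvd_mul hp] at h1
      rcases h1 with h | h | h <;> have := Nat.le_of_dvd (by norm_num) h <;> omega
    exact this

theorem gcd_30030 (p : ℕ) (hp : p.Prime) (h7 : 7 ≤ p) :
    p = 7 ∨ p = 11 ∨ p = 13 ∨ Nat.gcd p 30030 = 1 := by
  by_cases h : p ∣ 30030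
  · rw [show 30030 = 2 * (3 * (5 * (7 * (11 * 13)))) by norm_num] at h
    simp only [Nat.Prime.dvd_mul hp] at h
    rw [Nat.prime_dvd_prime_iff_eq hp (by norm_num), Nat.prime_dvd_prime_iff_eq hp (by norm_num),
      Nat.prime_dvd_prime_iff_eq hp (by norm_num), Nat.prime_dvd_prime_iff_eq hp (by norm_num),
      Nat.prime_dvd_prime_iff_eq hp (by norm_num), Nat.prime_dvd_prime_iff_eq hp (by norm_num)] at h
    omega
  · right; right; right
    exact (Nat.Prime.coprime_iff_not_dvd hp).2 h

namespace Quint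

variable {K : Type*} [Field K] [NumberField K] (Q : Quint K)

theorem el_eq (a b c : ℤ) : Q.el ⟨a, b, c, 0, 0⟩ =
    a + b * Q.el ⟨0, 1, 0, 0, 0⟩ + c * Q.el ⟨0, 1, 0, 0, 0⟩ ^ 2 := by
  rw [pow_two, ← el_mul, ← el_smul, ← el_smul, ← el_int, ← el_add, ← el_add]
  congr 1
  simp [Z5.mul, Z5.add, Z5.smul]

theorem th_rel : Q.el ⟨0, 1, 0, 0, 0⟩ ^ 5 = 5 * Q.el ⟨0, 1, 0, 0, 0⟩ ^ 4
    + 20 * Q.el ⟨0, 1, 0, 0, 0⟩ ^ 3 + 20 * Q.el ⟨0, 1, 0, 0, 0⟩ ^ 2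
    + 20 * Q.el ⟨0, 1, 0, 0, 0⟩ + 20 := by
  apply RingOfIntegers.ext
  have h := Q.rel
  have e : ((Q.el ⟨0, 1, 0, 0, 0⟩ : 𝓞 K) : K) = Q.pb.gen := by simp [coe_el, elK, Z5.ev]
  change algebraMap (𝓞 K) K _ = algebraMap (𝓞 K) K _
  simp only [map_add, map_mul, map_pow, map_ofNat]
  change ((Q.el ⟨0, 1, 0, 0, 0⟩ : 𝓞 K) : K) ^ 5 = 5 * ((Q.el ⟨0, 1, 0, 0, 0⟩ : 𝓞 K) : K) ^ 4
    + 20 * ((Q.el ⟨0, 1, 0, 0, 0⟩ : 𝓞 K) : K) ^ 3 + 20 * ((Q.el ⟨0, 1, 0, 0, 0⟩ : 𝓞 K) : K) ^ 2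
    + 20 * ((Q.el ⟨0, 1, 0, 0, 0⟩ : 𝓞 K) : K) + 20
  rw [e, h]

theorem cond_small (Q : Quint K) (R : Ideal (𝓞 K)) [hR : R.IsPrime] (p : ℕ) (hp : p.Prime) (h7 : p < 7)
    (hpR : (p : 𝓞 K) ∈ R) : R.IsPrincipal := by
  have : ∃ i, R = Ideal.span {Q.pS i} := by
    apply Q.prime_over_S
    interval_cases p
    · exact absurd hp (by norm_num)
    · exact absurd hp (by norm_num)
    · left; exact_mod_cast hpR
    · right; left; exact_mod_cast hpR
    · exact absurd hp (by norm_num)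
    · right; right; exact_mod_cast hpR
    · exact absurd hp (by norm_num)
  obtain ⟨i, hi⟩ := this
  exact ⟨Q.pS i, hi⟩

theorem deg_one (Q : Quint K) (q : ℕ) : q.Prime → 7 ≤ q → q < 251 → ∀ P : Ideal (𝓞 K), P.IsPrime → P ≠ ⊥ →
    Ideal.absNorm P = q → P.IsPrincipal := by
  induction q using Nat.strong_induction_on with
  | _ q ih =>
  intro hq h7 h251 P hP hP0 hPq
  have hmax : P.IsMaximal := hP.isMaximal hP0
  have : Finite (𝓞 K ⧸ P) := (Ideal.absNorm_ne_zero_iff P).1 (by rw [hPq]; omega)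
  have := Fintype.ofFinite (𝓞 K ⧸ P)
  have hc : Fintype.card (𝓞 K ⧸ P) = q := by
    rw [← hPq, Ideal.absNorm_apply, Submodule.cardQuot_apply, Nat.card_eq_fintype_card]
  let e := ZMod.ringEquivOfPrime (𝓞 K ⧸ P) hq hc
  let φ : 𝓞 K →+* ZMod q := (e.symm : (𝓞 K ⧸ P) →+* ZMod q).comp (Ideal.Quotient.mk P)
  have hφ : ∀ x, φ x = 0 ↔ x ∈ P := by
    intro x
    simp [φ, Ideal.Quotient.eq_zero_iff_mem]
  have : NeZero q := ⟨hq.ne_zero⟩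
  set r : ℕ := (φ (Q.el ⟨0, 1, 0, 0, 0⟩)).val with hr
  have hr' : φ (Q.el ⟨0, 1, 0, 0, 0⟩) = (r : ZMod q) := by simp [hr]
  have hrq : r < q := ZMod.val_lt _
  have hroot : r ^ 5 % q = (5 * r ^ 4 + 20 * r ^ 3 + 20 * r ^ 2 + 20 * r + 20) % q := by
    have := congrArg φ Q.th_rel
    simp only [map_add, map_mul, map_pow, map_ofNat, hr'] at this
    apply (ZMod.natCast_eq_natCast_iff' _ _ _).1
    push_cast
    exact this
  have ht := tab_root q h251 r hrq
  simp only [rootOK, Bool.or_eq_true, Bool.not_eq_true', decide_eq_true_eq, decide_eq_false_iff_not,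
    List.any_eq_true, Bool.and_eq_true] at ht
  rcases ht with ((ht | ht) | ht) | ht
  · omega
  · exact absurd (gcd_30030 q hq h7) ht
  · exact absurd hroot ht
  obtain ⟨⟨p', r', a, b, c⟩, hmem, h1, h2⟩ := ht
  simp only at h1 h2
  subst h1 h2
  obtain ⟨n1, n2, n3, n4, n5⟩ := tab_norm _ hmem
  simp only at n1 n2 n3 n4 n5
  set N := Z5.nrm ⟨a, b, c, 0, 0⟩ / 1024 with hN
  have hnorm := Q.norm_val _ _ n2
  refine princ_of_mem P (Q.el ⟨a, b, c, 0, 0⟩) ?_ ?_ (N.natAbs / p') ?_ ?_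
  · intro h0
    rw [h0, Algebra.norm_zero] at hnorm
    omega
  · rw [← hφ, el_eq]
    simp only [map_add, map_mul, map_pow, map_intCast, hr']
    have := (ZMod.intCast_zmod_eq_zero_iff_dvd (a + b * r + c * r ^ 2 : ℤ) p').2
      (Int.dvd_of_emod_eq_zero n1)
    push_cast at this
    exact this
  · rw [hnorm, hPq]; exact n4.symm
  · intro R hR hR0 hRd
    have hRm : R.IsMaximal := hR.isMaximal hR0
    obtain ⟨p, k, hk, hpR, hp, hRp⟩ := Ideal.exists_prime_and_absNorm_eq_pow R
    by_cases hp7 : p < 7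
    · exact Q.cond_small R p hp hp7 hpR
    · rw [hRp] at hRd
      obtain ⟨hk1, hlt⟩ := prime_pow_dvd_smo p p' k hp (by omega) (by omega) hk (hRd.trans n5)
      rw [hk1, pow_one] at hRp
      exact ih p hlt hp (by omega) (by omega) R hR hR0 hRp

end Quint

/-- Classification of the quadratic factors of the quintic modulo `q`. -/
def QC (q : ℕ) : Prop := ∀ A B : ZMod q,
    A ^ 4 + 3 * A ^ 2 * B + B ^ 2 - 5 * (A ^ 3 + 2 * A * B) - 20 * (A ^ 2 + B) - 20 * A - 20 = 0 →
    A ^ 3 * B + 2 * A * B ^ 2 - 5 * (A ^ 2 * B + B ^ 2) - 20 * A * B - 20 * B - 20 = 0 →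
    (∃ r, r ^ 2 = A * r + B) ∨ (q = 13 ∧ A = 3 ∧ B = 6)

theorem QC7 : QC 7 := by unfold QC; decide +kernel
theorem QC11 : QC 11 := by unfold QC; decide +kernel
theorem QC13 : QC 13 := by unfold QC; decide +kernel

namespace Quint

variable {K : Type*} [Field K] [NumberField K] (Q : Quint K)

theorem surj_of_linear (Q : Quint K) (q : ℕ) [Fact q.Prime] (h7 : 7 ≤ q) {F : Type*} [Field F] [CharP F q]
    (φ : 𝓞 K →+* F) (hφ : Function.Surjective φ) (r : ZMod q)
    (hr : φ (Q.el ⟨0, 1, 0, 0, 0⟩) = ZMod.castHom dvd_rfl F r) :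
    Function.Surjective (ZMod.castHom (dvd_refl q) F) := by
  set i := ZMod.castHom (dvd_refl q) F with hi
  have nz : ∀ n : ℕ, n < 7 → n ≠ 0 → (n : F) ≠ 0 := by
    intro n hn h0 h
    rw [CharP.cast_eq_zero_iff F q] at h
    have := Nat.le_of_dvd (by omega) h
    omega
  have h2 : (2 : F) ≠ 0 := by exact_mod_cast nz 2 (by norm_num) (by norm_num)
  have h3 : (3 : F) ≠ 0 := by exact_mod_cast nz 3 (by norm_num) (by norm_num)
  have h5 : (5 : F) ≠ 0 := by exact_mod_cast nz 5 (by norm_num) (by norm_num)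
  have hN : (16200000 : F) ≠ 0 := by
    have : (16200000 : F) = 2 ^ 6 * (3 ^ 4 * 5 ^ 5) := by norm_num
    rw [this]
    exact mul_ne_zero (pow_ne_zero _ h2) (mul_ne_zero (pow_ne_zero _ h3) (pow_ne_zero _ h5))
  have hZ : ∀ n : ℤ, (n : F) ∈ i.fieldRange := fun n => ⟨(n : ZMod q), by simp⟩
  have hO : ∀ n : ℕ, (n : F) ∈ i.fieldRange := fun n => ⟨(n : ZMod q), by simp⟩
  set t := φ (Q.el ⟨0, 1, 0, 0, 0⟩) with ht
  have htm : t ∈ i.fieldRange := ⟨r, hr.symm⟩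
  have h4el : ∀ y : Z5, 4 * Q.el y = y.a * 4 + (4 * y.b + 2 * y.e : ℤ) * Q.el ⟨0, 1, 0, 0, 0⟩
      + (4 * y.c + 2 * y.d : ℤ) * Q.el ⟨0, 1, 0, 0, 0⟩ ^ 2
      + (2 * y.d + y.e : ℤ) * Q.el ⟨0, 1, 0, 0, 0⟩ ^ 3 + y.e * Q.el ⟨0, 1, 0, 0, 0⟩ ^ 4 := by
    intro y
    have e : algebraMap (𝓞 K) K (Q.el ⟨0, 1, 0, 0, 0⟩) = Q.pb.gen := by
      change Q.elK _ = _
      simp [elK, Z5.ev]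
    apply RingOfIntegers.ext
    change algebraMap (𝓞 K) K _ = algebraMap (𝓞 K) K _
    simp only [map_add, map_mul, map_pow, map_ofNat, map_intCast, e]
    change 4 * Q.elK y = _
    simp only [elK, Z5.ev]; push_cast; field_simp; ring
  have h4 : (4 : F) ≠ 0 := by
    have : (4 : F) = 2 ^ 2 := by norm_num
    rw [this]; exact pow_ne_zero _ h2
  intro z
  obtain ⟨z, rfl⟩ := hφ z
  obtain ⟨y, hy⟩ := Q.span_el z
  have h1 : φ z = (y.a * 4 + (4 * y.b + 2 * y.e : ℤ) * t + (4 * y.c + 2 * y.d : ℤ) * t ^ 2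
      + (2 * y.d + y.e : ℤ) * t ^ 3 + y.e * t ^ 4) / ((4 : ℕ) * (16200000 : ℕ)) := by
    have e1 := congrArg φ (h4el y)
    have e2 := congrArg φ hy
    simp only [map_add, map_mul, map_pow, map_ofNat, map_intCast, ← ht] at e1 e2
    have hd : ((4 : ℕ) * (16200000 : ℕ) : F) ≠ 0 := by
      push_cast; exact mul_ne_zero h4 hN
    rw [eq_div_iff hd, ← e1, ← e2]
    push_cast
    ring
  change φ z ∈ i.fieldRange
  rw [h1]
  refine div_mem ?_ (mul_mem (hO _) (hO _))
  have h4m : (4 : F) ∈ i.fieldRange := by exact_mod_cast hO 4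
  exact add_mem (add_mem (add_mem (add_mem (mul_mem (hZ _) h4m) (mul_mem (hZ _) htm))
    (mul_mem (hZ _) (pow_mem htm _))) (mul_mem (hZ _) (pow_mem htm _))) (mul_mem (hZ _) (pow_mem htm _))

theorem deg_two_aux (Q : Quint K) (q : ℕ) [Fact q.Prime] (h7 : 7 ≤ q) (hQC : QC q) {F : Type*} [Field F]
    [CharP F q] [Fintype F] (hF : Fintype.card F = q ^ 2)
    (φ : 𝓞 K →+* F) (hφ : Function.Surjective φ) :
    q = 13 ∧ φ (Q.el ⟨-6, -3, 1, 0, 0⟩) = 0 := by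
  have hq := Fact.out (p := q.Prime)
  have hF1 : ∀ r : ZMod q, φ (Q.el ⟨0, 1, 0, 0, 0⟩) ≠ ZMod.castHom dvd_rfl F r := by
    intro r hr
    have h1 := Q.surj_of_linear q h7 φ hφ r hr
    have h2 := Fintype.card_le_of_surjective _ h1
    rw [hF, ZMod.card] at h2
    nlinarith
  set i := ZMod.castHom (dvd_refl q) F with hi
  set t := φ (Q.el ⟨0, 1, 0, 0, 0⟩) with ht
  have hinj : Function.Injective i := i.injective
  have hrel : t ^ 5 = 5 * t ^ 4 + 20 * t ^ 3 + 20 * t ^ 2 + 20 * t + 20 := by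
    have := congrArg φ Q.th_rel
    simpa only [map_add, map_mul, map_pow, map_ofNat, ← ht] using this
  -- no linear relation
  have hlin : ∀ x y : ZMod q, i x * t + i y = 0 → x = 0 ∧ y = 0 := by
    intro x y h
    by_cases hx : x = 0
    · subst hx
      simp only [map_zero, zero_mul, zero_add] at h
      exact ⟨rfl, (map_eq_zero i).1 h⟩
    · exfalso
      apply hF1 (-y / x)
      have hx' : i x ≠ 0 := by simpa using hx
      rw [map_div₀, map_neg, eq_div_iff hx']
      linear_combination h
  obtain ⟨⟨a, b, c⟩, ⟨a', b', c'⟩, hne, heq⟩ := Fintype.exists_ne_map_eq_of_card_lt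
    (fun x : ZMod q × ZMod q × ZMod q => i x.1 + i x.2.1 * t + i x.2.2 * t ^ 2)
    (by
      simp only [Fintype.card_prod, ZMod.card, hF]
      nlinarith [Nat.pos_of_ne_zero hq.ne_zero, pow_pos (Nat.pos_of_ne_zero hq.ne_zero) 2])
  simp only at heq
  have hc : c - c' ≠ 0 := by
    intro hc
    have hc' : c = c' := sub_eq_zero.1 hc
    subst hc'
    obtain ⟨h1, h2⟩ := hlin (b - b') (a - a') (by
      rw [map_sub, map_sub]; linear_combination heq)
    apply hne
    rw [sub_eq_zero.1 h1, sub_eq_zero.1 h2]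
  obtain ⟨A, hA⟩ : ∃ A, A = -(b - b') / (c - c') := ⟨_, rfl⟩
  obtain ⟨B, hB⟩ : ∃ B, B = -(a - a') / (c - c') := ⟨_, rfl⟩
  have hAc : i A * i (c - c') = - i (b - b') := by
    rw [← map_mul, ← map_neg, hA, div_mul_cancel₀ _ hc]
  have hBc : i B * i (c - c') = - i (a - a') := by
    rw [← map_mul, ← map_neg, hB, div_mul_cancel₀ _ hc]
  have hquad : t ^ 2 = i A * t + i B := by
    have hx' : i (c - c') ≠ 0 := fun h => hc ((map_eq_zero i).1 h)
    apply mul_left_cancel₀ hx'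
    simp only [map_sub] at hAc hBc ⊢
    linear_combination heq - t * hAc - hBc
  have key := hlin (A ^ 4 + 3 * A ^ 2 * B + B ^ 2 - 5 * (A ^ 3 + 2 * A * B) - 20 * (A ^ 2 + B) - 20 * A - 20)
    (A ^ 3 * B + 2 * A * B ^ 2 - 5 * (A ^ 2 * B + B ^ 2) - 20 * A * B - 20 * B - 20) (by
      simp only [map_add, map_sub, map_mul, map_pow, map_ofNat]
      linear_combination hrel - (t ^ 3 + i A * t ^ 2 + (i A ^ 2 + i B) * t + i A ^ 3 + 2 * i A * i B
        - 5 * (t ^ 2 + i A * t + i A ^ 2 + i B) - 20 * (t + i A) - 20) * hquad)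
  rcases hQC A B key.1 key.2 with ⟨r, hr⟩ | ⟨h13, hA3, hB6⟩
  · exfalso
    have hr' : i r ^ 2 = i A * i r + i B := by
      rw [← map_pow, hr, map_add, map_mul]
    have : (t - i r) * (t - i (A - r)) = 0 := by
      rw [map_sub]; linear_combination hquad - hr'
    rcases mul_eq_zero.1 this with h | h
    · exact hF1 r (sub_eq_zero.1 h)
    · exact hF1 _ (sub_eq_zero.1 h)
  · refine ⟨h13, ?_⟩
    rw [el_eq]
    simp only [map_add, map_mul, map_pow, map_intCast, ← ht]
    rw [hquad, hA3, hB6, map_ofNat, map_ofNat]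
    push_cast; ring

theorem deg_two (Q : Quint K) (q : ℕ) (hq : q = 7 ∨ q = 11 ∨ q = 13) (P : Ideal (𝓞 K)) (hP : P.IsPrime)
    (hP0 : P ≠ ⊥) (hqP : (q : 𝓞 K) ∈ P) (hPq : Ideal.absNorm P = q ^ 2) : P.IsPrincipal := by
  have hqp : q.Prime := by rcases hq with rfl | rfl | rfl <;> norm_num
  have hQC : QC q := by
    rcases hq with rfl | rfl | rfl
    · exact QC7
    · exact QC11
    · exact QC13
  have := Fact.mk hqp
  have hmax : P.IsMaximal := hP.isMaximal hP0
  have : Finite (𝓞 K ⧸ P) := (Ideal.absNorm_ne_zero_iff P).1 (by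
    rw [hPq]; exact pow_ne_zero _ hqp.ne_zero)
  have := Fintype.ofFinite (𝓞 K ⧸ P)
  have hc : Fintype.card (𝓞 K ⧸ P) = q ^ 2 := by
    rw [← hPq, Ideal.absNorm_apply, Submodule.cardQuot_apply, Nat.card_eq_fintype_card]
  let _ : Field (𝓞 K ⧸ P) := Ideal.Quotient.field P
  have : CharP (𝓞 K ⧸ P) q := (CharP.charP_iff_prime_eq_zero hqp).2 (by
    have := Ideal.Quotient.eq_zero_iff_mem.2 hqP
    simpa using this)
  obtain ⟨h13, h0⟩ := Q.deg_two_aux q (by omega) hQC hc (Ideal.Quotient.mk P)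
    Ideal.Quotient.mk_surjective
  have hmem := Ideal.Quotient.eq_zero_iff_mem.1 h0
  have hnrm : Algebra.norm ℤ (Q.el ⟨-6, -3, 1, 0, 0⟩) = 2704 ∨
      Algebra.norm ℤ (Q.el ⟨-6, -3, 1, 0, 0⟩) = -2704 := by
    have h := Q.norm_el ⟨-6, -3, 1, 0, 0⟩
    have h' : Z5.nrm ⟨-6, -3, 1, 0, 0⟩ = 1024 * 2704 ∨ Z5.nrm ⟨-6, -3, 1, 0, 0⟩ = 1024 * -2704 := by
      decide +kernel
    omega
  refine princ_of_mem P _ ?_ hmem 16 ?_ ?_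
  · intro h
    rw [h, Algebra.norm_zero] at hnrm
    omega
  · rw [hPq, h13]; omega
  · intro R hR hR0 hRd
    have hRm : R.IsMaximal := hR.isMaximal hR0
    obtain ⟨p, k, hk, hpR, hp, hRp⟩ := Ideal.exists_prime_and_absNorm_eq_pow R
    have h2 : p ∣ 2 ^ 4 := by
      rw [hRp] at hRd; exact (dvd_pow_self p hk.ne').trans hRd
    have := (Nat.prime_dvd_prime_iff_eq hp Nat.prime_two).1 (hp.dvd_of_dvd_pow h2)
    exact Q.cond_small R p hp (by omega) hpR

open scoped Real in
theorem isPID (Q : Quint K) : IsPrincipalIdealRing (𝓞 K) := by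
  apply RingOfIntegers.isPrincipalIdealRing_of_isPrincipal_of_norm_le_of_isPrime
  rintro ⟨P, hP0'⟩ hP hn
  simp only at hP hn ⊢
  have hP0 : P ≠ ⊥ := nonZeroDivisors.ne_zero hP0'
  have hM : (4 / π) ^ InfinitePlace.nrComplexPlaces K *
      ((finrank ℚ K).factorial / (finrank ℚ K : ℝ) ^ finrank ℚ K * √|discr K|) < 251 := by
    rw [Q.finrank_eq]
    have hr := InfinitePlace.card_add_two_mul_card_eq_rank K
    rw [Q.finrank_eq] at hr
    have hr2 : InfinitePlace.nrComplexPlaces K ≤ 2 := by omega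
    have hpi : 3.14 < π := Real.pi_gt_d2
    have hpi4 : π ≤ 4 := Real.pi_le_four
    have h1 : (4 / π) ^ InfinitePlace.nrComplexPlaces K ≤ (4 / π) ^ 2 :=
      pow_le_pow_right₀ (by rw [le_div_iff₀ (by linarith)]; linarith) hr2
    have h2 : (4 / π) ^ 2 ≤ (4 / 3.14) ^ 2 := by
      gcongr
    have h3 : √|(discr K : ℝ)| ≤ 4025 := by
      apply Real.sqrt_le_iff.2 ⟨by norm_num, ?_⟩
      have := Q.discr_le
      have h4 : |(discr K : ℝ)| ≤ 16200000 := by exact_mod_cast this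
      refine h4.trans (by norm_num)
    have h5 : (0 : ℝ) ≤ √|(discr K : ℝ)| := Real.sqrt_nonneg _
    have h6 : ((Nat.factorial 5 : ℕ) : ℝ) / ((5 : ℕ) : ℝ) ^ 5 = 120 / 3125 := by
      norm_num [Nat.factorial]
    rw [h6]
    calc _ ≤ (4 / 3.14 : ℝ) ^ 2 * (120 / 3125 * 4025) := by
          apply mul_le_mul (h1.trans h2) _ (by positivity) (by positivity)
          gcongr
      _ < 251 := by norm_num
  have hlt : Ideal.absNorm P < 251 := by
    have := lt_of_le_of_lt hn (by simpa using hM)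
    exact_mod_cast this
  have hmax : P.IsMaximal := hP.isMaximal hP0
  obtain ⟨p, k, hk, hpR, hp, hRp⟩ := Ideal.exists_prime_and_absNorm_eq_pow P
  by_cases hp7 : p < 7
  · exact Q.cond_small P p hp hp7 hpR
  have hk2 : k < 3 := by
    by_contra hk3
    have h1 : 7 ^ 3 ≤ p ^ 3 := Nat.pow_le_pow_left (by omega) 3
    have h2 : p ^ 3 ≤ p ^ k := Nat.pow_le_pow_right (by omega) (by omega)
    omega
  interval_cases k
  · rw [pow_one] at hRp
    exact Q.deg_one p hp (by omega) (by omega) P hP hP0 hRp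
  · have hp16 : p < 16 := by
      by_contra h
      have h1 : 16 ^ 2 ≤ p ^ 2 := Nat.pow_le_pow_left (by omega) 2
      omega
    refine Q.deg_two p ?_ P hP hP0 hpR hRp
    interval_cases p <;> revert hp <;> norm_num

end Quint

theorem quint_pos (x : ℝ) (h : x ^ 5 = 5 * x ^ 4 + 20 * x ^ 3 + 20 * x ^ 2 + 20 * x + 20) : 0 < x := by
  by_contra hx
  obtain ⟨y, rfl⟩ : ∃ y, x = -y := ⟨-x, by ring⟩
  have hy : 0 ≤ y := by linarith
  have h1 : 0 < y ^ 5 + 5 * y ^ 4 - 20 * y ^ 3 + 20 * y ^ 2 - 20 * y + 20 := by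
    have e1 := sq_nonneg (y ^ 2 - 31 / 20 * y)
    have e2 := mul_nonneg hy (sq_nonneg (y ^ 2 - 31 / 20 * y))
    have e3 := mul_nonneg hy (sq_nonneg (y - 31 / 20))
    have e4 := sq_nonneg (y - 31 / 20)
    have e5 := mul_nonneg hy (sq_nonneg (y ^ 2 - (31 / 20) ^ 2))
    have e6 := sq_nonneg (y ^ 2 - (31 / 20) ^ 2)
    nlinarith [mul_nonneg hy hy, pow_nonneg hy 3]
  have h2 : -y ^ 5 = 5 * y ^ 4 - 20 * y ^ 3 + 20 * y ^ 2 - 20 * y + 20 := by linear_combination h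
  linarith

theorem quint_le (x z : ℝ) (h : x ^ 5 = 5 * x ^ 4 + 20 * x ^ 3 + 20 * x ^ 2 + 20 * x + 20)
    (h' : z ^ 5 = 5 * z ^ 4 + 20 * z ^ 3 + 20 * z ^ 2 + 20 * z + 20) : z ≤ x := by
  by_contra hlt
  have hx := quint_pos x h
  have hz := quint_pos z h'
  have hd : 0 < z - x := by linarith
  have : 0 < (z - x) * (5 * x ^ 4 * z ^ 4 + 20 * x ^ 3 * z ^ 3 * (z + x)
    + 20 * x ^ 2 * z ^ 2 * (z ^ 2 + z * x + x ^ 2)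
    + 20 * x * z * (z ^ 3 + z ^ 2 * x + z * x ^ 2 + x ^ 3)
    + 20 * (z ^ 4 + z ^ 3 * x + z ^ 2 * x ^ 2 + z * x ^ 3 + x ^ 4)) := by positivity
  have h0 : (z - x) * (5 * x ^ 4 * z ^ 4 + 20 * x ^ 3 * z ^ 3 * (z + x)
    + 20 * x ^ 2 * z ^ 2 * (z ^ 2 + z * x + x ^ 2)
    + 20 * x * z * (z ^ 3 + z ^ 2 * x + z * x ^ 2 + x ^ 3)
    + 20 * (z ^ 4 + z ^ 3 * x + z ^ 2 * x ^ 2 + z * x ^ 3 + x ^ 4)) = 0 := by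
    linear_combination x ^ 5 * h' - z ^ 5 * h
  linarith

namespace Quint

variable {K : Type*} [Field K] [NumberField K] (Q : Quint K)

theorem rank_eq (Q : Quint K) : Units.rank K = 2 := by
  classical
  have h1 : InfinitePlace.nrRealPlaces K ≤ 1 := by
    rw [← InfinitePlace.card_real_embeddings, Fintype.card_le_one_iff_subsingleton]
    refine ⟨fun φ ψ => ?_⟩
    have hroot : ∀ φ : { φ : K →+* ℂ // ComplexEmbedding.IsReal φ },
        (φ.2.embedding Q.pb.gen) ^ 5 = 5 * (φ.2.embedding Q.pb.gen) ^ 4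
        + 20 * (φ.2.embedding Q.pb.gen) ^ 3 + 20 * (φ.2.embedding Q.pb.gen) ^ 2
        + 20 * (φ.2.embedding Q.pb.gen) + 20 := by
      intro φ
      have := congrArg φ.2.embedding Q.rel
      simpa only [map_add, map_mul, map_pow, map_ofNat] using this
    have h2 : φ.2.embedding Q.pb.gen = ψ.2.embedding Q.pb.gen :=
      le_antisymm (quint_le _ _ (hroot ψ) (hroot φ)) (quint_le _ _ (hroot φ) (hroot ψ))
    have h3 : φ.1 Q.pb.gen = ψ.1 Q.pb.gen := by
      rw [← ComplexEmbedding.IsReal.coe_embedding_apply φ.2,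
        ← ComplexEmbedding.IsReal.coe_embedding_apply ψ.2, h2]
    have h4 : φ.1.toRatAlgHom = ψ.1.toRatAlgHom := Q.pb.algHom_ext (by simpa using h3)
    apply Subtype.ext
    ext x
    exact congrFun (congrArg DFunLike.coe h4) x
  have hr := InfinitePlace.card_add_two_mul_card_eq_rank K
  rw [Q.finrank_eq] at hr
  rw [Units.rank, InfinitePlace.card_eq_nrRealPlaces_add_nrComplexPlaces]
  omega

end Quint

/-- Exponent products with exponents in `ZMod 2`. -/
def prodE {G : Type*} [CommMonoid G] (g : Fin 8 → G) (e : Fin 8 → ZMod 2) : G :=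
  ∏ i, g i ^ (e i).val

theorem prodE_add {G : Type*} [CommMonoid G] (g : Fin 8 → G) (e e' : Fin 8 → ZMod 2) :
    ∃ z, prodE g e * prodE g e' = prodE g (e + e') * z ^ 2 := by
  have h : ∀ i, ∃ z, g i ^ (e i).val * g i ^ (e' i).val = g i ^ ((e + e') i).val * z ^ 2 := by
    intro i
    have key : ∀ a b : ZMod 2, a.val + b.val = (a + b).val ∨ a.val + b.val = (a + b).val + 2 := by
      decide
    rcases key (e i) (e' i) with h | h
    · exact ⟨1, by rw [← pow_add, h, Pi.add_apply]; simp⟩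
    · exact ⟨g i, by rw [← pow_add, h, Pi.add_apply, pow_add]⟩
  choose z hz using h
  refine ⟨∏ i, z i, ?_⟩
  simp only [prodE, ← Finset.prod_mul_distrib, ← Finset.prod_pow, hz]

theorem prodE_zero {G : Type*} [CommMonoid G] (g : Fin 8 → G) : prodE g 0 = 1 := by
  simp [prodE]

theorem prodE_single {G : Type*} [CommMonoid G] (g : Fin 8 → G) (i : Fin 8) :
    prodE g (Pi.single i 1) = g i := by
  rw [prodE, Finset.prod_eq_single i]
  · simp [ZMod.val_one]
  · intro j _ hj; simp [Pi.single_eq_of_ne hj]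
  · simp

/-- The subgroup generated by eight elements and all squares. -/
def subA {G : Type*} [CommGroup G] (g : Fin 8 → G) : Subgroup G where
  carrier := {x | ∃ e z, x = prodE g e * z ^ 2}
  one_mem' := ⟨0, 1, by simp [prodE_zero]⟩
  mul_mem' := by
    rintro a b ⟨e, z, rfl⟩ ⟨e', z', rfl⟩
    obtain ⟨y, hy⟩ := prodE_add g e e'
    refine ⟨e + e', y * z * z', ?_⟩
    rw [mul_mul_mul_comm, hy, mul_pow, mul_pow]
    simp only [mul_assoc]
  inv_mem' := by
    rintro a ⟨e, z, rfl⟩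
    refine ⟨e, (prodE g e)⁻¹ * z⁻¹, ?_⟩
    rw [mul_inv, mul_pow, pow_two (prodE g e)⁻¹, ← mul_assoc, ← mul_assoc, mul_inv_cancel,
      one_mul, inv_pow]

theorem sq_mem_subA {G : Type*} [CommGroup G] (g : Fin 8 → G) (z : G) : z ^ 2 ∈ subA g :=
  ⟨0, z, by simp [prodE_zero]⟩

theorem gen_mem_subA {G : Type*} [CommGroup G] (g : Fin 8 → G) (i : Fin 8) : g i ∈ subA g :=
  ⟨Pi.single i 1, 1, by simp [prodE_single]⟩

/-- If eight elements of the subgroup are independent modulo squares, they generate it modulo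
squares. -/
theorem subA_gen {G : Type*} [CommGroup G] (g x : Fin 8 → G) (hx : ∀ i, x i ∈ subA g)
    (hi : ∀ e, e ≠ 0 → ¬ ∃ z, prodE x e = z ^ 2) (a : G) (ha : a ∈ subA g) :
    ∃ e z, a * prodE x e = z ^ 2 := by
  have hm : ∀ e, prodE x e ∈ subA g := fun e =>
    Subgroup.prod_mem _ fun i _ => Subgroup.pow_mem _ (hx i) _
  choose E Z hE using hm
  have inj : Function.Injective E := by
    intro f f' h
    by_contra hne
    obtain ⟨y, hy⟩ := prodE_add x f f'
    have h0 : f + f' ≠ 0 := by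
      intro h0
      apply hne
      funext i
      have := congrFun h0 i
      have key : ∀ a b : ZMod 2, a + b = 0 → a = b := by decide
      exact key _ _ this
    apply hi _ h0
    refine ⟨prodE g (E f) * Z f * Z f' * y⁻¹, ?_⟩
    rw [eq_comm, mul_pow, inv_pow, mul_inv_eq_iff_eq_mul, ← hy, hE f, hE f', h]
    simp only [pow_two]
    ac_rfl
  have sur := Finite.injective_iff_surjective.mp inj
  obtain ⟨e, z, rfl⟩ := ha
  obtain ⟨f, rfl⟩ := sur e
  refine ⟨f, prodE g (E f) * z * Z f, ?_⟩
  rw [hE f]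
  simp only [pow_two]
  ac_rfl

namespace Quint

variable {K : Type*} [Field K] [NumberField K] (Q : Quint K)

theorem exists_gens (Q : Quint K) : ∃ g : Fin 8 → Kˣ,
    (∀ u : (𝓞 K)ˣ, Units.map (algebraMap (𝓞 K) K).toMonoidHom u ∈ subA g) ∧
    (∀ i : Fin 5, ∃ j, ((g j : Kˣ) : K) = Q.pS i) := by
  obtain ⟨ζ, hζ⟩ := IsCyclic.exists_generator (α := Units.torsion K)
  have hp : ∀ i, ((Q.pS i : 𝓞 K) : K) ≠ 0 := fun i => by
    simpa using Q.pS_ne i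
  let m := Units.map (algebraMap (𝓞 K) K).toMonoidHom
  let i0 : Fin (Units.rank K) := ⟨0, by rw [Q.rank_eq]; omega⟩
  let i1 : Fin (Units.rank K) := ⟨1, by rw [Q.rank_eq]; omega⟩
  let g : Fin 8 → Kˣ := ![m ζ, m (Units.fundSystem K i0), m (Units.fundSystem K i1),
    Units.mk0 _ (hp 0), Units.mk0 _ (hp 1), Units.mk0 _ (hp 2), Units.mk0 _ (hp 3),
    Units.mk0 _ (hp 4)]
  refine ⟨g, ?_, ?_⟩
  · intro u
    have hu : u ∈ Subgroup.closure (Set.range (Units.fundSystem K)) ⊔ Units.torsion K := by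
      rw [Units.closure_fundSystem_sup_torsion_eq_top]; trivial
    have hle : Subgroup.closure (Set.range (Units.fundSystem K)) ⊔ Units.torsion K
        ≤ (subA g).comap m := by
      apply sup_le
      · rw [Subgroup.closure_le]
        rintro _ ⟨i, rfl⟩
        have : i = i0 ∨ i = i1 := by
          have h2 := i.2
          have h3 := Q.rank_eq
          have : i.1 = 0 ∨ i.1 = 1 := by omega
          rcases this with h | h
          · left; exact Fin.ext h
          · right; exact Fin.ext h
        rcases this with rfl | rfl
        · exact gen_mem_subA g 1
        · exact gen_mem_subA g 2
      · intro t ht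
        obtain ⟨n, hn⟩ := hζ ⟨t, ht⟩
        have : t = (ζ : (𝓞 K)ˣ) ^ n := by
          have := congrArg Subtype.val hn
          simpa using this.symm
        rw [this]
        exact Subgroup.zpow_mem _ (show (ζ : (𝓞 K)ˣ) ∈ (subA g).comap m from gen_mem_subA g 0) _
    exact hle hu
  · intro i
    fin_cases i
    exacts [⟨3, rfl⟩, ⟨4, rfl⟩, ⟨5, rfl⟩, ⟨6, rfl⟩, ⟨7, rfl⟩]

/-- Primes away from `30` divide `a` to even order. -/
def EvenAway (a : 𝓞 K) : Prop :=
  ∀ p : 𝓞 K, Prime p → ¬ p ∣ 30 → ∀ n : ℕ, p ^ (2 * n + 1) ∣ a → p ^ (2 * n + 2) ∣ a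

theorem mem_of_even (g : Fin 8 → Kˣ)
    (hu : ∀ u : (𝓞 K)ˣ, Units.map (algebraMap (𝓞 K) K).toMonoidHom u ∈ subA g)
    (hg : ∀ i : Fin 5, ∃ j, ((g j : Kˣ) : K) = Q.pS i) (a : 𝓞 K) (ha : a ≠ 0)
    (he : EvenAway a) : ∃ x ∈ subA g, ((x : Kˣ) : K) = a := by
  have := Q.isPID
  revert ha he
  refine WellFounded.induction (r := DvdNotUnit) wellFounded_dvdNotUnit
    (C := fun a => a ≠ 0 → EvenAway a → ∃ x ∈ subA g, ((x : Kˣ) : K) = a) a ?_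
  intro a ih ha he
  by_cases hua : IsUnit a
  · obtain ⟨u, rfl⟩ := hua
    exact ⟨_, hu u, rfl⟩
  obtain ⟨q, hq, hqa⟩ := WfDvdMonoid.exists_irreducible_factor hua ha
  have hp : Prime q := hq.prime
  have hmem : ∀ (x : Kˣ) (b : 𝓞 K), x ∈ subA g → (x : K) = b → ∀ u : (𝓞 K)ˣ,
      ∃ y ∈ subA g, (y : K) = ((b * u : 𝓞 K) : K) := by
    intro x b hx hb u
    refine ⟨x * Units.map (algebraMap (𝓞 K) K).toMonoidHom u, mul_mem hx (hu u), ?_⟩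
    rw [Units.val_mul, hb]; rfl
  by_cases h30 : q ∣ 30
  · obtain ⟨i, hi⟩ := Q.prime_dvd_S q hp h30
    obtain ⟨b, rfl⟩ := hqa
    have hb : b ≠ 0 := right_ne_zero_of_mul ha
    obtain ⟨x, hx, hxb⟩ := ih b ⟨hb, q, hp.not_isUnit, mul_comm _ _⟩ hb (by
      intro p hpp hp30 n hn
      have h1 := he p hpp hp30 n (hn.mul_left q)
      have hpq : ¬ p ∣ q := fun h => hp30 (h.trans h30)
      exact hpp.pow_dvd_of_dvd_mul_left _ hpq h1)
    obtain ⟨j, hj⟩ := hg i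
    obtain ⟨u, hu'⟩ := hi.symm
    obtain ⟨y, hy, hyb⟩ := hmem (g j) _ (gen_mem_subA g j) hj u
    refine ⟨y * x, mul_mem hy hx, ?_⟩
    rw [Units.val_mul, hyb, hxb, hu']; rfl
  · have h2 := he q hp h30 0 (by simpa using hqa)
    obtain ⟨b, rfl⟩ := h2
    simp only [mul_zero, zero_add] at *
    have hb : b ≠ 0 := right_ne_zero_of_mul ha
    have hq2 : ¬ IsUnit (q ^ 2) := fun h => hp.not_isUnit (isUnit_pow_iff (by norm_num) |>.1 h)
    obtain ⟨x, hx, hxb⟩ := ih b ⟨hb, q ^ 2, hq2, mul_comm _ _⟩ hb (by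
      intro p hpp hp30 n hn
      by_cases hpq : p ∣ q
      · have hass := hpp.associated_of_dvd hp hpq
        have h1 : p ^ (2 * (n + 1) + 1) ∣ q ^ 2 * b := by
          rw [show 2 * (n + 1) + 1 = 2 + (2 * n + 1) by ring, pow_add]
          exact mul_dvd_mul (hass.pow_pow).dvd hn
        have h3 := he p hpp hp30 (n + 1) h1
        rw [show 2 * (n + 1) + 2 = 2 + (2 * n + 2) by ring, pow_add] at h3
        have h4 : q ^ 2 * p ^ (2 * n + 2) ∣ q ^ 2 * b :=
          ((hass.symm.pow_pow (n := 2)).mul_right _).dvd.trans h3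
        exact (mul_dvd_mul_iff_left (pow_ne_zero 2 hp.ne_zero)).1 h4
      · have h1 := he p hpp hp30 n (hn.mul_left _)
        exact hpp.pow_dvd_of_dvd_mul_left _ (fun h => hpq (hpp.dvd_of_dvd_pow h)) h1)
    have hqK : (q : K) ≠ 0 := by simpa using hp.ne_zero
    refine ⟨Units.mk0 (q : K) hqK ^ 2 * x, mul_mem (sq_mem_subA g _) hx, ?_⟩
    rw [Units.val_mul, hxb, Units.val_pow_eq_pow_val]
    rfl

end Quint

/-- The eight generators modulo squares. -/
def xG (i : Fin 8) : Z5 := ![⟨2, 1, 1, 3, 3⟩, ⟨-1, 0, 0, 0, 0⟩, ⟨1, 1, 0, 0, 0⟩, ⟨3, 0, 0, 0, 0⟩,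
  ⟨0, 1, 0, -4, 1⟩, ⟨0, 2, 0, -4, 1⟩, ⟨0, -3, -4, 1, 0⟩, ⟨4, -1, 0, 4, -1⟩] i

/-- Cofactors: `xG i * yG i` is the norm. -/
def yG (i : Fin 8) : Z5 := ![⟨51, 17, 17, 51, -14⟩, ⟨1, 0, 0, 0, 0⟩, ⟨-14, -8, -7, -14, 4⟩,
  ⟨81, 0, 0, 0, 0⟩, ⟨-135, -57, -24, -147, 39⟩, ⟨300, 150, 5, 390, -100⟩,
  ⟨-460, 158, -199, -922, 244⟩, ⟨81, 135, 108, -135, 27⟩] i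

/-- The norms of the generators. -/
def nG (i : Fin 8) : ℤ := ![2, -1, 6, 243, -45, 200, 3840, 729] i

theorem xG_mul_yG (i : Fin 8) : (xG i).mul (yG i) = ⟨nG i, 0, 0, 0, 0⟩ := by
  revert i; decide +kernel

theorem xG_nrm (i : Fin 8) : (xG i).nrm = 1024 * nG i := by
  revert i; decide +kernel

theorem nG_dvd (i : Fin 8) : nG i ∣ 30 ^ 8 := by
  revert i; decide +kernel

/-- One factor. -/
def Z5.pw (x : Z5) (e : ZMod 2) : Z5 := if e = 0 then ⟨1, 0, 0, 0, 0⟩ else x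

/-- The product of the generators with exponents `e`. -/
def xs (e0 e1 e2 e3 e4 e5 e6 e7 : ZMod 2) : Z5 :=
  ((((((((xG 0).pw e0).mul ((xG 1).pw e1)).mul ((xG 2).pw e2)).mul ((xG 3).pw e3)).mul
    ((xG 4).pw e4)).mul ((xG 5).pw e5)).mul ((xG 6).pw e6)).mul ((xG 7).pw e7)

/-- Euler criterion value is `0` or `1`. -/
def chk (p r t : ℕ) (x : Z5) : Bool :=
  let a : ZMod p := Z5.ev (r : ZMod p) (t : ZMod p) x
  decide (a ^ ((p - 1) / 2) = 0 ∨ a ^ ((p - 1) / 2) = 1)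

/-- All eight characters. -/
def chkAll (x : Z5) : Bool :=
  chk 7 1 4 x && chk 13 5 7 x && chk 13 7 7 x && chk 23 9 12 x && chk 13 3 7 x && chk 29 2 15 x &&
    chk 29 23 15 x && chk 31 16 16 x

set_option maxRecDepth 100000 in
theorem chk_indep_bool : ∀ e0 e1 e2 e3 e4 e5 e6 e7 : ZMod 2,
    (!chkAll (xs e0 e1 e2 e3 e4 e5 e6 e7) || (e0 == 0 && e1 == 0 && e2 == 0 && e3 == 0 && e4 == 0 &&
      e5 == 0 && e6 == 0 && e7 == 0)) = true := by
  decide +kernel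

theorem chk_indep : ∀ e0 e1 e2 e3 e4 e5 e6 e7 : ZMod 2,
    chkAll (xs e0 e1 e2 e3 e4 e5 e6 e7) = true →
    e0 = 0 ∧ e1 = 0 ∧ e2 = 0 ∧ e3 = 0 ∧ e4 = 0 ∧ e5 = 0 ∧ e6 = 0 ∧ e7 = 0 := by
  intro e0 e1 e2 e3 e4 e5 e6 e7 h
  have := chk_indep_bool e0 e1 e2 e3 e4 e5 e6 e7
  rw [h] at this
  simpa [and_assoc] using this

namespace Quint

variable {K : Type*} [Field K] [NumberField K] (Q : Quint K)

theorem el_pw (x : Z5) (e : ZMod 2) : Q.el (x.pw e) = Q.el x ^ e.val := by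
  have : e = 0 ∨ e = 1 := by revert e; decide
  rcases this with rfl | rfl
  · simp [Z5.pw, el_int]
  · simp [Z5.pw, ZMod.val_one]

theorem el_xs (e : Fin 8 → ZMod 2) :
    Q.el (xs (e 0) (e 1) (e 2) (e 3) (e 4) (e 5) (e 6) (e 7)) = prodE (fun i => Q.el (xG i)) e := by
  simp only [xs, el_mul, el_pw, prodE, Fin.prod_univ_eight]

theorem sq_ev {R : Type*} [CommRing R] (r t c : R) (ht : 2 * t = 1)
    (hr : r ^ 5 = 5 * r ^ 4 + 20 * r ^ 3 + 20 * r ^ 2 + 20 * r + 20) (hc : c * 16200000 = 1)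
    (x : Z5) (z : 𝓞 K) (h : Q.el x = z ^ 2) : ∃ s : R, Z5.ev r t x = s ^ 2 := by
  obtain ⟨y, hy⟩ := Q.span_el z
  have h1 : Q.el (y.mul y) = Q.el (x.smul (16200000 ^ 2)) := by
    rw [el_mul, ← hy, el_smul, h]; push_cast; ring
  have h2 := Q.el_inj _ _ h1
  have h3 := congrArg (Z5.ev r t) h2
  rw [Z5.ev_mul r t ht hr, Z5.ev_smul] at h3
  refine ⟨c * Z5.ev r t y, ?_⟩
  have : c ^ 2 * 16200000 ^ 2 = 1 := by rw [← mul_pow, hc, one_pow]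
  push_cast at h3
  linear_combination (-c ^ 2) * h3 - Z5.ev r t x * this

theorem chk_of_sq (p r t c : ℕ) (hp2 : p ≠ 2) (ht : (2 * t : ZMod p) = 1)
    (hr : (r ^ 5 : ZMod p) = 5 * r ^ 4 + 20 * r ^ 3 + 20 * r ^ 2 + 20 * r + 20)
    (hc : (c * 16200000 : ZMod p) = 1) [hp : Fact p.Prime] (x : Z5) (z : 𝓞 K) (h : Q.el x = z ^ 2) :
    chk p r t x = true := by
  obtain ⟨s, hs⟩ := Q.sq_ev (r : ZMod p) t c ht hr hc x z h
  simp only [chk, decide_eq_true_eq]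
  rw [hs, ← pow_mul, Nat.mul_div_cancel' ((hp.out.even_sub_one hp2).two_dvd)]
  by_cases h0 : s = 0
  · left; rw [h0, zero_pow]; have := hp.out.two_le; omega
  · right; exact ZMod.pow_card_sub_one_eq_one h0

theorem chkAll_of_sq (x : Z5) (z : 𝓞 K) (h : Q.el x = z ^ 2) : chkAll x = true := by
  have : Fact (Nat.Prime 7) := ⟨by norm_num⟩
  have : Fact (Nat.Prime 13) := ⟨by norm_num⟩
  have : Fact (Nat.Prime 23) := ⟨by norm_num⟩
  have : Fact (Nat.Prime 29) := ⟨by norm_num⟩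
  have : Fact (Nat.Prime 31) := ⟨by norm_num⟩
  simp only [chkAll, Bool.and_eq_true]
  refine ⟨⟨⟨⟨⟨⟨⟨?_, ?_⟩, ?_⟩, ?_⟩, ?_⟩, ?_⟩, ?_⟩, ?_⟩
  · exact Q.chk_of_sq 7 1 4 3 (by decide) (by decide) (by decide) (by decide) x z h
  · exact Q.chk_of_sq 13 5 7 6 (by decide) (by decide) (by decide) (by decide) x z h
  · exact Q.chk_of_sq 13 7 7 6 (by decide) (by decide) (by decide) (by decide) x z h
  · exact Q.chk_of_sq 23 9 12 17 (by decide) (by decide) (by decide) (by decide) x z h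
  · exact Q.chk_of_sq 13 3 7 6 (by decide) (by decide) (by decide) (by decide) x z h
  · exact Q.chk_of_sq 29 2 15 16 (by decide) (by decide) (by decide) (by decide) x z h
  · exact Q.chk_of_sq 29 23 15 16 (by decide) (by decide) (by decide) (by decide) x z h
  · exact Q.chk_of_sq 31 16 16 14 (by decide) (by decide) (by decide) (by decide) x z h

theorem xG_dvd (i : Fin 8) : Q.el (xG i) ∣ 30 ^ 8 := by
  have h1 : Q.el (xG i) ∣ ((nG i : ℤ) : 𝓞 K) :=
    ⟨Q.el (yG i), by rw [← el_mul, xG_mul_yG, el_int]⟩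
  have h2 : ((nG i : ℤ) : 𝓞 K) ∣ ((30 ^ 8 : ℤ) : 𝓞 K) := map_dvd (Int.castRingHom (𝓞 K)) (nG_dvd i)
  have := h1.trans h2
  rwa [Int.cast_pow, Int.cast_ofNat] at this

theorem xG_ne (i : Fin 8) : Q.el (xG i) ≠ 0 := by
  intro h
  have h1 := Q.xG_dvd i
  rw [h, zero_dvd_iff] at h1
  norm_num at h1

theorem xG_even (i : Fin 8) : EvenAway (Q.el (xG i)) := by
  intro p hp h30 n hn
  exact absurd (hp.dvd_of_dvd_pow ((dvd_pow_self p (by omega)).trans (hn.trans (Q.xG_dvd i)))) h30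

/-- An element of `K` whose square is integral is integral. -/
theorem int_of_sq (a : 𝓞 K) (z : K) (h : (a : K) = z ^ 2) : ∃ b : 𝓞 K, a = b ^ 2 ∧ (b : K) = z := by
  have hz : IsIntegral ℤ z := IsIntegral.of_pow (n := 2) (by norm_num) (by rw [← h]; exact a.2)
  refine ⟨⟨z, hz⟩, ?_, rfl⟩
  apply RingOfIntegers.ext
  rw [h]; rfl

/-- The descent statement. -/
theorem descent (a : 𝓞 K) (ha : a ≠ 0) (he : EvenAway a) :
    ∃ e0 e1 e2 e3 e4 e5 e6 e7 : ZMod 2, ∃ z : 𝓞 K,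
      a * Q.el (xs e0 e1 e2 e3 e4 e5 e6 e7) = z ^ 2 := by
  obtain ⟨g, hu, hg⟩ := Q.exists_gens
  have hx : ∀ i, ∃ x ∈ subA g, ((x : Kˣ) : K) = Q.el (xG i) := fun i =>
    Q.mem_of_even g hu hg _ (Q.xG_ne i) (Q.xG_even i)
  choose x hxm hxe using hx
  obtain ⟨A, hA, hAa⟩ := Q.mem_of_even g hu hg a ha he
  have hprod : ∀ e, ((prodE x e : Kˣ) : K) =
      algebraMap (𝓞 K) K (Q.el (xs (e 0) (e 1) (e 2) (e 3) (e 4) (e 5) (e 6) (e 7))) := by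
    intro e
    rw [el_xs]
    simp only [prodE, Units.coe_prod, Units.val_pow_eq_pow_val, hxe, map_prod, map_pow]
  obtain ⟨e, z, hz⟩ := subA_gen g x hxm (by
    rintro e hne ⟨z, hz⟩
    have h1 := congrArg (Units.val) hz
    rw [hprod, Units.val_pow_eq_pow_val] at h1
    obtain ⟨b, hb, -⟩ := int_of_sq _ _ h1
    have h2 := chk_indep _ _ _ _ _ _ _ _ (Q.chkAll_of_sq _ b hb)
    apply hne
    obtain ⟨h0, h1, h2, h3, h4, h5, h6, h7⟩ := h2
    funext i
    fin_cases i <;> assumption) A hA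
  have h1 := congrArg (Units.val) hz
  rw [Units.val_mul, hprod, Units.val_pow_eq_pow_val, hAa] at h1
  have h2 : algebraMap (𝓞 K) K (a * Q.el (xs (e 0) (e 1) (e 2) (e 3) (e 4) (e 5) (e 6) (e 7)))
    = (z : K) ^ 2 := by rw [map_mul, ← h1]
  obtain ⟨b, hb, -⟩ := int_of_sq _ _ h2
  exact ⟨_, _, _, _, _, _, _, _, b, hb⟩

end Quint

section Forms

/-- Coefficientwise addition. -/
def addL {α : Type*} [Add α] (l m : List α) : List α := List.zipWith (· + ·) l m

/-- Product of coefficient lists. -/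
def mulL {α : Type*} [Add α] [Mul α] [Zero α] : List α → List α → List α
  | [], m => List.replicate (m.length - 1) 0
  | a :: l, m => addL (m.map (a * ·) ++ List.replicate l.length 0) (0 :: mulL l m)

/-- Evaluation of the binary form with given coefficients (of `vⁿ, u vⁿ⁻¹, …`). -/
def hev {R : Type*} [CommRing R] (l : List R) (u v : R) : R :=
  match l with
  | [] => 0
  | a :: l => a * v ^ l.length + u * hev l u v

theorem length_mulL {α : Type*} [Add α] [Mul α] [Zero α] (l m : List α) (hm : m ≠ []) :
    (mulL l m).length = l.length + m.length - 1 := by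
  have := List.length_pos_iff.2 hm
  induction l with
  | nil => simp [mulL]
  | cons a l ih => simp only [mulL, addL, List.length_zipWith, List.length_append, List.length_map,
      List.length_replicate, List.length_cons, ih]; omega

variable {R : Type*} [CommRing R]

theorem hev_addL (l m : List R) (u v : R) (h : l.length = m.length) :
    hev (addL l m) u v = hev l u v + hev m u v := by
  induction l generalizing m with
  | nil => cases m with
    | nil => simp [addL, hev]
    | cons => simp at h
  | cons a l ih => cases m with
    | nil => simp at h
    | cons b m =>
      simp only [List.length_cons, Nat.add_right_cancel_iff] at h
      have := ih m h
      simp only [addL] at this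
      simp only [addL, List.zipWith_cons_cons, hev, this, List.length_zipWith, h, min_self]
      ring

theorem hev_zeros (k : ℕ) (u v : R) : hev (List.replicate k 0) u v = 0 := by
  induction k with
  | zero => simp [hev]
  | succ k ih => simp [List.replicate_succ, hev, ih]

theorem hev_append_zeros (l : List R) (k : ℕ) (u v : R) :
    hev (l ++ List.replicate k 0) u v = v ^ k * hev l u v := by
  induction l with
  | nil => simp [hev_zeros, hev]
  | cons a l ih =>
    simp only [List.cons_append, hev, ih, List.length_append, List.length_replicate,
      pow_add]
    ring

theorem hev_map_mul (l : List R) (a u v : R) : hev (l.map (a * ·)) u v = a * hev l u v := by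
  induction l with
  | nil => simp [hev]
  | cons b l ih => simp only [List.map_cons, hev, ih, List.length_map]; ring

theorem hev_mulL (l m : List R) (u v : R) (hm : m ≠ []) :
    hev (mulL l m) u v = hev l u v * hev m u v := by
  induction l with
  | nil => simp [mulL, hev_zeros, hev]
  | cons a l ih =>
    have hpos := List.length_pos_iff.2 hm
    rw [mulL, hev_addL, hev_append_zeros, hev_map_mul, hev, hev, ih]
    · ring
    · simp only [List.length_append, List.length_map, List.length_replicate, List.length_cons,
        length_mulL l m hm]
      omega

theorem hev_map {S : Type*} [CommRing S] (φ : R →+* S) (l : List R) (u v : R) :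
    hev (l.map φ) (φ u) (φ v) = φ (hev l u v) := by
  induction l with
  | nil => simp [hev]
  | cons a l ih => simp [hev, ih]

theorem hev_hom (l : List R) (d u v : R) :
    hev l (d * u) (d * v) * d = d ^ l.length * hev l u v := by
  induction l with
  | nil => simp [hev]
  | cons a l ih =>
    simp only [hev, List.length_cons]
    linear_combination d * u * ih

theorem map_addL {α β : Type*} [Add α] [Add β] (φ : α → β)
    (ha : ∀ x y, φ (x + y) = φ x + φ y) (l m : List α) :
    (addL l m).map φ = addL (l.map φ) (m.map φ) := by
  simp [addL, List.map_zipWith, List.zipWith_map, ha]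

theorem map_mulL {α β : Type*} [Add α] [Mul α] [Zero α] [Add β] [Mul β] [Zero β] (φ : α → β)
    (ha : ∀ x y, φ (x + y) = φ x + φ y) (hm : ∀ x y, φ (x * y) = φ x * φ y) (h0 : φ 0 = 0)
    (l m : List α) : (mulL l m).map φ = mulL (l.map φ) (m.map φ) := by
  induction l with
  | nil => simp [mulL, h0]
  | cons a l ih =>
    simp only [mulL, List.map_cons, List.length_map, ← ih, map_addL φ ha, List.map_append,
      List.map_map, List.map_replicate, h0]
    congr 3
    funext x
    exact hm a x

end Forms

/-- The coefficients of `h`. -/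
def hl : List ℤ :=
    [55, 348, -462, -660, -4455, -11880, -10692, 7128, -4455, -5940, -8910, -5508, 567]

/-- The coefficients of `g`. -/
def gl : List ℤ :=
    [-1226, 380, -25840, -160740, -490770, -347472, 328320, -2831760, -4935060, -6135480,
    1493856, 10937160, 13204620, 24747120, 20684160, 3767472, -5401890, 277020, -1108080,
    -772740, -287226]

/-- The coefficients of `f`. -/
def fl : List ℤ :=
    [-36599, 240930, 1657785, 11693960, 34087905, 49546674, 254142225, 1307923200,
    2375837325, 1812605850, -2443371075, -1782891000, 5260879125, 2309654250, 19632061125,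
    50258076480, 106013130075, 156594558150, 139272151275, 28882834200, -78311866365,
    -84387472650, -64658162925, -72150004800, -27156143025, 1161021438, 2936802015,
    -2717041320, -1104511545, -631233810, -153743913]

theorem syzygy_list : addL (mulL fl fl) (mulL gl (mulL gl gl)) =
    (mulL hl (mulL (mulL hl hl) (mulL hl hl))).map ((-1) * ·) := by
  decide +kernel

theorem syzygy (u v : ℤ) : hev fl u v ^ 2 + hev gl u v ^ 3 = -hev hl u v ^ 5 := by
  have h := congrArg (fun l => hev l u v) syzygy_list
  simp only [hev_map_mul] at h
  rw [hev_addL _ _ _ _ (by decide +kernel), hev_mulL _ _ _ _ (by decide +kernel),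
    hev_mulL _ _ _ _ (by decide +kernel), hev_mulL _ _ _ _ (by decide +kernel),
    hev_mulL _ _ _ _ (by decide +kernel), hev_mulL _ _ _ _ (by decide +kernel),
    hev_mulL _ _ _ _ (by decide +kernel)] at h
  linear_combination h

/-- Bezout cofactor of `h` for `v³¹`. -/
def bh_v : List ℤ :=
    [27936434024, -86220961534, -785926510506, -3315202449574, -3222169301940,
    5161137432528, -17733320375568, -32223903211872, -48715211140668, 714860066196,
    73856861576820, 79334213513940, 172026665020980, 156992164670880, 35315122596336,
    -42648007946544, 3261681386964, -7874072179974, -5734556373546, -2245765808286]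

/-- Bezout cofactor of `g` for `v³¹`. -/
def bg_v : List ℤ :=
    [-3365258180, 3018701507, 1605132735, 23732284455, 80359396260, 91551691638,
    -60066111798, 29442763350, 37639962360, 63698449815, 43672740111, -4433265837]

theorem bez_v (u v : ℤ) :
    hev bh_v u v * hev hl u v + hev bg_v u v * hev gl u v = 5662310400000 * v ^ 31 := by
  have h : addL (mulL bh_v hl) (mulL bg_v gl) = 5662310400000 :: List.replicate 31 0 := by
    decide +kernel
  rw [← hev_mulL _ _ _ _ (by decide +kernel), ← hev_mulL _ _ _ _ (by decide +kernel),
    ← hev_addL _ _ _ _ (by decide +kernel), h]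
  simp [hev]

/-- Bezout cofactor of `h` for `u³¹`. -/
def bh_u : List ℤ :=
    [44915244374, -4065675614, 938932088094, 6101519133996, 19170649951024, 16137368210832,
    -10676447302752, 101003087323292, 205250854390428, 252387079886172, -15654500989476,
    -425411115849684, -553266921665376, -982774540752624, -933967478429136,
    -235515530925468, 190675669355838, 16306709555682, 24349058417718, 57896005194792]

/-- Bezout cofactor of `g` for `u³¹`. -/
def bg_u : List ℤ :=
    [2014957945, 13191335157, -14337878555, -29062507760, -165820050110, -470273200210,
    -471446632734, 208207931580, -93656816715, -298355565915, -325730224215, -273736432836]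

theorem bez_u (u v : ℤ) :
    hev bh_u u v * hev hl u v + hev bg_u u v * hev gl u v = 111451255603200000 * u ^ 31 := by
  have h : addL (mulL bh_u hl) (mulL bg_u gl) = List.replicate 31 0 ++ [111451255603200000] := by
    decide +kernel
  rw [← hev_mulL _ _ _ _ (by decide +kernel), ← hev_mulL _ _ _ _ (by decide +kernel),
    ← hev_addL _ _ _ _ (by decide +kernel), h]
  simp [hev, List.replicate]; ring

instance : Add Z5 := ⟨Z5.add⟩

instance : Mul Z5 := ⟨Z5.mul⟩

instance : Zero Z5 := ⟨⟨0, 0, 0, 0, 0⟩⟩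

/-- The coefficients of the sextic factor over the quintic field. -/
def wl : List Z5 :=
    [⟨-77, -14, 7, -104, 26⟩, ⟨-378, -162, -60, -408, 108⟩, ⟨-675, -390, -45, -570, 150⟩, ⟨1140, 780, 360, 1320, -360⟩, ⟨1305, 990, 585, 1620, -450⟩, ⟨-306, -162, 36, -432, 108⟩, ⟨351, 54, 45, 486, -126⟩]

/-- Integers as coordinate vectors. -/
def Z5.ofInt (n : ℤ) : Z5 := ⟨n, 0, 0, 0, 0⟩

/-- The cofactor of the sextic. -/
def bl : List Z5 :=
  addL (mulL (mulL wl wl) (mulL wl wl)) (addL (mulL ((hl.map (30 * ·)).map Z5.ofInt) (mulL wl wl))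
    ((mulL hl (hl.map (405 * ·))).map Z5.ofInt))

theorem wl_bl : mulL wl bl = (fl.map (648 * ·)).map Z5.ofInt := by
  decide +kernel

/-- Evaluation of forms with coefficients in `Z5`. -/
def zev (l : List Z5) (u v : ℤ) : Z5 :=
  match l with
  | [] => ⟨0, 0, 0, 0, 0⟩
  | a :: l => (a.smul (v ^ l.length)).add ((zev l u v).smul u)

theorem ev_zev {R : Type*} [CommRing R] (r t : R) (l : List Z5) (u v : ℤ) :
    Z5.ev r t (zev l u v) = hev (l.map (Z5.ev r t)) (u : R) (v : R) := by
  induction l with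
  | nil => simp [zev, hev, Z5.ev]
  | cons a l ih =>
    simp only [zev, Z5.ev_add, Z5.ev_smul, ih, List.map_cons, hev, List.length_map]
    push_cast
    ring

namespace Quint

variable {K : Type*} [Field K] [NumberField K] (Q : Quint K)

theorem el_zev (l : List Z5) (u v : ℤ) :
    Q.el (zev l u v) = hev (l.map Q.el) (u : 𝓞 K) (v : 𝓞 K) := by
  induction l with
  | nil => simpa [zev, hev] using Q.el_int 0
  | cons a l ih =>
    simp only [zev, el_add, el_smul, ih, List.map_cons, hev, List.length_map]
    push_cast
    ring

theorem hev_cast (l : List ℤ) (u v : ℤ) :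
    hev ((l.map Z5.ofInt).map Q.el) (u : 𝓞 K) (v : 𝓞 K) = ((hev l u v : ℤ) : 𝓞 K) := by
  rw [← eq_intCast (Int.castRingHom (𝓞 K)) (hev l u v), ← hev_map]
  simp only [eq_intCast, List.map_map]
  congr 2
  funext n
  exact Q.el_int n

/-- The sextic factor. -/
noncomputable def w (u v : ℤ) : 𝓞 K := Q.el (zev wl u v)

/-- The factorisation over the quintic field. -/
theorem w_mul (u v : ℤ) :
    Q.w u v * (Q.w u v ^ 4 + 30 * (hev hl u v : ℤ) * Q.w u v ^ 2 + 405 * (hev hl u v : ℤ) ^ 2)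
      = 648 * (hev fl u v : ℤ) := by
  have ha : ∀ x y : Z5, Q.el (x + y) = Q.el x + Q.el y := Q.el_add
  have hm : ∀ x y : Z5, Q.el (x * y) = Q.el x * Q.el y := Q.el_mul
  have h0 : Q.el 0 = 0 := (Q.el_int 0).trans Int.cast_zero
  have h := congrArg (fun l => hev (l.map Q.el) (u : 𝓞 K) (v : 𝓞 K)) wl_bl
  simp only [hev_cast, hev_map_mul, bl] at h
  simp only [map_mulL Q.el ha hm h0, map_addL Q.el ha] at h
  rw [hev_mulL _ _ _ _ (by simp [wl, hl, addL, mulL]), hev_addL, hev_mulL _ _ _ _ (by simp [wl, mulL, addL]),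
    hev_mulL _ _ _ _ (by simp [wl]), hev_addL, hev_mulL _ _ _ _ (by simp [wl, mulL, addL]),
    hev_mulL _ _ _ _ (by simp [wl]), hev_cast, hev_cast, hev_mulL _ _ _ _ (by simp [hl]),
    hev_map_mul, hev_map_mul, ← el_zev] at h
  · rw [w]
    push_cast at h
    linear_combination h
  all_goals simp [wl, hl, mulL, addL]

end Quint

theorem cop_mod (u v : ℤ) (h : IsCoprime u v) (p : ℕ) (hp : p ≠ 1) :
    ¬ ((u : ZMod p) = 0 ∧ (v : ZMod p) = 0) := by
  rintro ⟨hu, hv⟩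
  obtain ⟨a, b, hab⟩ := h
  have h1 := congrArg (Int.cast : ℤ → ZMod p) hab
  push_cast at h1
  rw [hu, hv, mul_zero, mul_zero, add_zero] at h1
  have := (ZMod.natCast_eq_zero_iff 1 p).1 (by rw [Nat.cast_one]; exact h1.symm)
  exact hp (Nat.dvd_one.1 this)

theorem hev_zmod (p : ℕ) (l : List ℤ) (u v : ℤ) :
    ((hev l u v : ℤ) : ZMod p) = hev (l.map (Int.cast : ℤ → ZMod p)) (u : ZMod p) (v : ZMod p) := by
  rw [← eq_intCast (Int.castRingHom (ZMod p)) (hev l u v), ← hev_map]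
  simp only [eq_intCast]
  rfl

theorem f_mod_19 : ∀ u v : ZMod 19, (u = 0 ∧ v = 0) ∨ hev (fl.map (Int.cast : ℤ → ZMod 19)) u v ≠ 0 := by
  decide +kernel

theorem f_ne (u v : ℤ) (h : IsCoprime u v) : hev fl u v ≠ 0 := by
  intro h0
  have h1 := hev_zmod 19 fl u v
  rw [h0, Int.cast_zero] at h1
  rcases f_mod_19 u v with h2 | h2
  · exact cop_mod u v h 19 (by norm_num) h2
  · exact h2 h1.symm

theorem prime_pow_sq {R : Type*} [CommRing R] [IsDomain R] (p : R) (hp : Prime p) (n : ℕ) (y : R)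
    (h : p ^ (2 * n + 1) ∣ y ^ 2) : p ^ (n + 1) ∣ y := by
  induction n generalizing y with
  | zero => simpa using hp.dvd_of_dvd_pow (by simpa using h)
  | succ n ih =>
    have h1 : p ∣ y := hp.dvd_of_dvd_pow ((dvd_pow_self p (by omega)).trans h)
    obtain ⟨x, rfl⟩ := h1
    have h2 : p ^ 2 * p ^ (2 * n + 1) ∣ p ^ 2 * x ^ 2 := by
      rw [← pow_add, ← mul_pow, show 2 + (2 * n + 1) = 2 * (n + 1) + 1 by ring]; exact h
    have h3 := ih x ((mul_dvd_mul_iff_left (pow_ne_zero 2 hp.ne_zero)).1 h2)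
    rw [pow_succ']
    exact mul_dvd_mul_left p h3

namespace Quint

variable {K : Type*} [Field K] [NumberField K] (Q : Quint K)

theorem w_ne (u v : ℤ) (h : IsCoprime u v) : Q.w u v ≠ 0 := by
  intro h0
  have h1 := Q.w_mul u v
  rw [h0, zero_mul, eq_comm, mul_eq_zero] at h1
  rcases h1 with h1 | h1
  · norm_num at h1
  · exact f_ne u v h (by exact_mod_cast h1)

theorem w_even (u v y : ℤ) (h : IsCoprime u v) (hy : y ^ 2 = hev fl u v) : EvenAway (Q.w u v) := by
  intro p hp h30 n hn
  have hcast : ∀ (a b : ℕ) (m x : ℤ), m ∣ 30 ^ a → p ∣ ((m * x ^ (b + 1) : ℤ) : 𝓞 K) →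
      p ∣ (x : 𝓞 K) := by
    intro a b m x hm hd
    push_cast at hd
    rcases hp.dvd_or_dvd hd with hd | hd
    · have := hd.trans (map_dvd (Int.castRingHom (𝓞 K)) hm)
      rw [map_pow] at this
      refine absurd (hp.dvd_of_dvd_pow this) ?_
      simpa using h30
    · exact hp.dvd_of_dvd_pow hd
  have hmul := Q.w_mul u v
  have hpw : p ∣ Q.w u v := (dvd_pow_self p (by omega)).trans hn
  have hβ : ¬ p ∣ (Q.w u v ^ 4 + 30 * (hev hl u v : ℤ) * Q.w u v ^ 2 + 405 * (hev hl u v : ℤ) ^ 2) := by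
    intro hβ
    have hh : p ∣ ((hev hl u v : ℤ) : 𝓞 K) := by
      refine hcast 4 1 405 _ (by norm_num) ?_
      have h2 : p ∣ Q.w u v ^ 4 + 30 * (hev hl u v : ℤ) * Q.w u v ^ 2 :=
        dvd_add (dvd_pow hpw (by norm_num)) ((dvd_pow hpw (by norm_num)).mul_left _)
      have := (dvd_add_right h2).1 hβ
      push_cast
      exact this
    have hf : p ∣ ((hev fl u v : ℤ) : 𝓞 K) := by
      refine hcast 4 0 648 _ (by norm_num) ?_
      push_cast
      rw [pow_one, ← hmul]
      exact hpw.mul_right _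
    have hg : p ∣ ((hev gl u v : ℤ) : 𝓞 K) := by
      have h1 := congrArg (Int.cast : ℤ → 𝓞 K) (syzygy u v)
      push_cast at h1
      have h2 : ((hev gl u v : ℤ) : 𝓞 K) ^ 3 = -((hev hl u v : ℤ) : 𝓞 K) ^ 5
        - ((hev fl u v : ℤ) : 𝓞 K) ^ 2 := by linear_combination h1
      apply hp.dvd_of_dvd_pow (n := 3)
      rw [h2]
      exact dvd_sub ((dvd_pow hh (by norm_num)).neg_right) (dvd_pow hf (by norm_num))
    have hv : p ∣ (v : 𝓞 K) := by
      refine hcast 30 30 5662310400000 _ (by norm_num) ?_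
      rw [← bez_v u v]
      push_cast
      exact dvd_add (hh.mul_left _) (hg.mul_left _)
    have hu : p ∣ (u : 𝓞 K) := by
      refine hcast 30 30 111451255603200000 _ (by norm_num) ?_
      rw [← bez_u u v]
      push_cast
      exact dvd_add (hh.mul_left _) (hg.mul_left _)
    obtain ⟨a, b, hab⟩ := h
    have h1 := congrArg (Int.cast : ℤ → 𝓞 K) hab
    push_cast at h1
    apply hp.not_isUnit
    rw [isUnit_iff_dvd_one, ← h1]
    exact dvd_add (hu.mul_left _) (hv.mul_left _)
  have h648 : ¬ p ∣ 648 := fun hd => by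
    have := hcast 4 0 648 1 (by norm_num) (by simpa using hd)
    exact hp.not_isUnit (isUnit_iff_dvd_one.2 (by simpa using this))
  rw [← hy] at hmul
  push_cast at hmul
  have h1 : p ^ (2 * n + 1) ∣ (y : 𝓞 K) ^ 2 := by
    apply hp.pow_dvd_of_dvd_mul_left _ h648
    rw [← hmul]
    exact hn.mul_right _
  have h2 := prime_pow_sq p hp n _ h1
  apply hp.pow_dvd_of_dvd_mul_right _ hβ
  push_cast
  rw [hmul, show 2 * n + 2 = (n + 1) * 2 by ring, pow_mul]
  exact (pow_dvd_pow_of_dvd h2 2).mul_left _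

/-- Residue map modulo the prime `Q2`. -/
theorem par (x : Z5) : Q.pS 0 ∣ Q.el x - ((x.a + x.d + x.e : ℤ) : 𝓞 K) := by
  have h : x = (Z5.add ⟨x.a + x.d + x.e, 0, 0, 0, 0⟩ (Z5.mul ⟨2, 1, 1, 3, 3⟩
      ((((⟨-35, -14, -14, -32, 9⟩ : Z5).smul x.b).add ((⟨45, 15, 18, 35, -10⟩ : Z5).smul x.c)).add
      (((⟨-28, -6, -11, -25, 7⟩ : Z5).smul x.d).add ((⟨-43, -17, -13, -44, 12⟩ : Z5).smul x.e))))) := by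
    obtain ⟨a, b, c, d, e⟩ := x
    simp only [Z5.add, Z5.mul, Z5.smul, Z5.mk.injEq]
    refine ⟨?_, ?_, ?_, ?_, ?_⟩ <;> ring
  have h2 := congrArg Q.el h
  rw [el_add, el_mul, el_int] at h2
  refine Dvd.intro _ ((sub_eq_of_eq_add' h2).symm)

theorem par_odd (x : Z5) (h : Odd (x.a + x.d + x.e)) : ¬ Q.pS 0 ∣ Q.el x := by
  intro hd
  have h1 := (dvd_sub_right hd).1 (Q.par x)
  obtain ⟨k, hk⟩ := h
  have h2 : Q.pS 0 ∣ 2 := by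
    refine ⟨Q.el ⟨51, 17, 17, 51, -14⟩, ?_⟩
    rw [show Q.pS 0 = Q.el ⟨2, 1, 1, 3, 3⟩ from rfl, ← el_mul]
    exact Int.cast_ofNat (R := 𝓞 K) 2 |>.symm.trans (Q.el_int 2).symm
  rw [hk] at h1
  push_cast at h1
  exact (Q.pS_prime 0).not_isUnit (isUnit_iff_dvd_one.2 ((dvd_add_right (h2.mul_right _)).1 h1))

end Quint

/-- The reduced sextic at odd `u` and `v`: coefficients in `s = (u - v) / 2`. -/
def wl' : List Z5 := [⟨170, 137, 116, 239, -68⟩, ⟨1872, 1218, 930, 2412, -672⟩,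
  ⟨6390, 3540, 2790, 8040, -2220⟩, ⟨10320, 4200, 3960, 13200, -3600⟩,
  ⟨10080, 1980, 2880, 13500, -3600⟩, ⟨7200, 648, 1224, 9936, -2592⟩, ⟨2808, 432, 360, 3888, -1008⟩]

theorem wl_odd (s v : ℤ) : zev wl (v + 2 * s) v = (zev wl' s v).smul 8 := by
  simp only [wl, wl', zev, Z5.add, Z5.smul, Z5.mk.injEq, List.length_cons, List.length_nil]
  refine ⟨?_, ?_, ?_, ?_, ?_⟩ <;> ring

/-- Residue in the field with two elements. -/
def Z5.p2 (x : Z5) : ZMod 2 := x.a + x.d + x.e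

theorem Z5.p2_odd (x : Z5) (h : x.p2 = 1) : Odd (x.a + x.d + x.e) := by
  have h1 : ((x.a + x.d + x.e : ℤ) : ZMod 2) = 1 := by rw [← h]; simp [Z5.p2]
  exact ZMod.intCast_eq_one_iff_odd.1 h1

theorem p2_zev (l : List Z5) (u v : ℤ) :
    (zev l u v).p2 = hev (l.map Z5.p2) (u : ZMod 2) (v : ZMod 2) := by
  induction l with
  | nil => simp [zev, hev, Z5.p2]
  | cons a l ih =>
    simp only [zev, List.map_cons, hev, List.length_map, ← ih]
    simp only [Z5.p2, Z5.add, Z5.smul]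
    push_cast
    ring

theorem p2_wl (v : ZMod 2) : v = 1 → hev (wl.map Z5.p2) 0 v = 1 := by
  revert v; decide +kernel

theorem p2_wl' : ∀ s v : ZMod 2, v = 1 → hev (wl'.map Z5.p2) s v = 1 := by
  decide +kernel

theorem p2_xs : ∀ e1 e2 e3 e4 e5 e6 e7 : ZMod 2, (xs 0 e1 e2 e3 e4 e5 e6 e7).p2 = 1 := by
  decide +kernel

theorem f_mod_8 : ∀ a b y : ZMod 8,
    y ^ 2 ≠ hev (fl.map (Int.cast : ℤ → ZMod 8)) (2 * a + 1) (2 * b) := by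
  decide +kernel

theorem odd_contra {R : Type*} [CommRing R] [IsDomain R] (p : R) (hp : Prime p) (n : ℕ) (x z : R)
    (hx : ¬ p ∣ x) (h : p ^ (2 * n + 1) * x = z ^ 2) : False := by
  have h1 := prime_pow_sq p hp n z ⟨x, h.symm⟩
  have h2 := pow_dvd_pow_of_dvd h1 2
  rw [← h, ← pow_mul, show (n + 1) * 2 = (2 * n + 1) + 1 by ring, pow_succ] at h2
  exact hx ((mul_dvd_mul_iff_left (pow_ne_zero _ hp.ne_zero)).1 h2)

namespace Quint

variable {K : Type*} [Field K] [NumberField K] (Q : Quint K)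

theorem two_eq : ∃ k : 𝓞 K, (2 : 𝓞 K) = Q.pS 0 ^ 4 * k ∧ ¬ Q.pS 0 ∣ k := by
  refine ⟨Q.el ⟨892172, 427231, 197456, 990493, -264982⟩, ?_, Q.par_odd _ (by decide)⟩
  rw [show Q.pS 0 = Q.el ⟨2, 1, 1, 3, 3⟩ from rfl,
    show (4 : ℕ) = 2 + 2 from rfl, pow_add, pow_two, ← el_mul, ← el_mul, ← el_mul]
  exact Int.cast_ofNat (R := 𝓞 K) 2 |>.symm.trans (Q.el_int 2).symm

theorem e0_zero (u v y : ℤ) (h : IsCoprime u v) (hy : y ^ 2 = hev fl u v)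
    (e0 e1 e2 e3 e4 e5 e6 e7 : ZMod 2) (z : 𝓞 K)
    (hz : Q.w u v * Q.el (xs e0 e1 e2 e3 e4 e5 e6 e7) = z ^ 2) : e0 = 0 := by
  have key : ∀ e : ZMod 2, e = 0 ∨ e = 1 := by decide
  rcases key e0 with rfl | rfl
  · rfl
  exfalso
  have hp := Q.pS_prime 0
  have hxs : Q.el (xs 1 e1 e2 e3 e4 e5 e6 e7) = Q.pS 0 * Q.el (xs 0 e1 e2 e3 e4 e5 e6 e7) := by
    simp only [xs, el_mul, el_pw, show Q.pS 0 = Q.el (xG 0) from rfl]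
    simp [ZMod.val_one]
    ring
  have hx0 := Q.par_odd _ (Z5.p2_odd _ (p2_xs e1 e2 e3 e4 e5 e6 e7))
  rw [hxs] at hz
  rcases Int.even_or_odd u with hu | hu <;> rcases Int.even_or_odd v with hv | hv
  · refine cop_mod u v h 2 (by norm_num) ⟨?_, ?_⟩
    · exact (ZMod.intCast_zmod_eq_zero_iff_dvd u 2).2 hu.two_dvd
    · exact (ZMod.intCast_zmod_eq_zero_iff_dvd v 2).2 hv.two_dvd
  · have hw : ¬ Q.pS 0 ∣ Q.w u v := by
      apply Q.par_odd _ (Z5.p2_odd _ _)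
      rw [p2_zev, (ZMod.intCast_zmod_eq_zero_iff_dvd u 2).2 hu.two_dvd]
      exact p2_wl _ (ZMod.intCast_eq_one_iff_odd.2 hv)
    refine odd_contra (Q.pS 0) hp 0 (Q.w u v * Q.el (xs 0 e1 e2 e3 e4 e5 e6 e7)) z ?_ ?_
    · exact fun hd => (hp.dvd_or_dvd hd).elim hw hx0
    · rw [← hz]; ring
  · obtain ⟨a, rfl⟩ := hu
    obtain ⟨b, rfl⟩ := hv
    apply f_mod_8 a b y
    have h1 := hev_zmod 8 fl (2 * a + 1) (b + b)
    rw [← hy] at h1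
    push_cast at h1
    rw [h1, _root_.two_mul (b : ZMod 8)]
  · obtain ⟨s, hs⟩ : ∃ s, u = v + 2 * s := by
      obtain ⟨a, ha⟩ := hu
      obtain ⟨b, hb⟩ := hv
      exact ⟨a - b, by omega⟩
    obtain ⟨k, hk, hkp⟩ := Q.two_eq
    have hw : Q.w u v = Q.pS 0 ^ 12 * (k ^ 3 * Q.el (zev wl' s v)) := by
      rw [w, hs, wl_odd, el_smul]
      have : ((8 : ℤ) : 𝓞 K) = 2 ^ 3 := by norm_num
      rw [this, hk]; ring
    have hw' : ¬ Q.pS 0 ∣ Q.el (zev wl' s v) := by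
      apply Q.par_odd _ (Z5.p2_odd _ _)
      rw [p2_zev]
      exact p2_wl' _ _ (ZMod.intCast_eq_one_iff_odd.2 hv)
    refine odd_contra (Q.pS 0) hp 6
      ((k ^ 3 * Q.el (zev wl' s v)) * Q.el (xs 0 e1 e2 e3 e4 e5 e6 e7)) z ?_ ?_
    · intro hd
      rcases hp.dvd_or_dvd hd with hd | hd
      · rcases hp.dvd_or_dvd hd with hd | hd
        · exact hkp (hp.dvd_of_dvd_pow hd)
        · exact hw' hd
      · exact hx0 hd
    · rw [← hz, hw]; ring

end Quint

theorem ev_mod_31 : ∀ u v : ZMod 31, (u = 0 ∧ v = 0) ∨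
    hev (wl.map (Z5.ev (16 : ZMod 31) 16)) u v ≠ hev (wl.map (Z5.ev (28 : ZMod 31) 16)) u v := by
  decide +kernel

namespace Quint

variable {K : Type*} [Field K] [NumberField K] (Q : Quint K)

theorem w_irr (u v : ℤ) (h : IsCoprime u v) (q : ℚ) : ((Q.w u v : 𝓞 K) : K) ≠ algebraMap ℚ K q := by
  intro hq
  have h0 : (algebraMap ℚ K q) * (q.den : K) = (q.num : K) := by
    rw [eq_ratCast]
    exact_mod_cast congrArg (Rat.cast : ℚ → K) (Rat.mul_den_eq_num q)
  have h1 : (zev wl u v).smul q.den = ⟨q.num, 0, 0, 0, 0⟩ := by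
    apply Q.elK_inj
    rw [elK_smul, show Q.elK (zev wl u v) = algebraMap ℚ K q from hq, ← coe_el, el_int]
    push_cast
    rw [mul_comm, h0]
    simp
  have hd : (q.den : ℤ) ≠ 0 := by exact_mod_cast q.den_nz
  simp only [Z5.smul, Z5.mk.injEq, mul_eq_zero, hd, false_or] at h1
  obtain ⟨-, hb, hc, hd, he⟩ := h1
  have h2 : ∀ r : ZMod 31, Z5.ev r 16 (zev wl u v) = ((zev wl u v).a : ZMod 31) := by
    intro r
    simp [Z5.ev, hb, hc, hd, he]
  rcases ev_mod_31 u v with h3 | h3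
  · exact cop_mod u v h 31 (by norm_num) h3
  · apply h3
    rw [← ev_zev, ← ev_zev, h2, h2]

theorem norm_w (u v : ℤ) (h : IsCoprime u v) : Algebra.norm ℤ (Q.w u v) = 648 * hev fl u v := by
  have h1 : ((Algebra.norm ℤ (Q.w u v) : ℤ) : ℚ) = 648 * (hev fl u v : ℤ) := by
    rw [Algebra.coe_norm_int]
    set x : K := (Q.w u v : K) with hx
    have hxm : x * (x ^ 4 + 30 * ((hev hl u v : ℤ) : K) * x ^ 2 + 405 * ((hev hl u v : ℤ) : K) ^ 2)
        = 648 * ((hev fl u v : ℤ) : K) := by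
      have := congrArg (algebraMap (𝓞 K) K) (Q.w_mul u v)
      simpa only [map_mul, map_add, map_pow, map_ofNat, map_intCast, ← hx] using this
    set H : ℚ := ((hev hl u v : ℤ) : ℚ) with hH
    set F : ℚ := ((hev fl u v : ℤ) : ℚ) with hF
    have hd : (minpoly ℚ x).natDegree ∣ 5 := by
      rw [← Q.finrank_eq]; exact minpoly.degree_dvd (Algebra.IsIntegral.isIntegral x)
    have hd5 : (minpoly ℚ x).natDegree = 5 := by
      rcases (Nat.dvd_prime Nat.prime_five).1 hd with h1 | h1
      · exfalso
        obtain ⟨q, hq⟩ := (minpoly.natDegree_eq_one_iff).1 h1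
        exact Q.w_irr u v h q hq.symm
      · exact h1
    let Φ : Polynomial ℚ := Polynomial.X ^ 5 + (Polynomial.C (30 * H) * Polynomial.X ^ 3
      + Polynomial.C (405 * H ^ 2) * Polynomial.X - Polynomial.C (648 * F))
    have hdeg : (Polynomial.C (30 * H) * Polynomial.X ^ 3
      + Polynomial.C (405 * H ^ 2) * Polynomial.X - Polynomial.C (648 * F)).degree ≤ 4 := by
      compute_degree!
    have hm : Φ.Monic := Polynomial.monic_X_pow_add (lt_of_le_of_lt hdeg (by norm_num))
    have hn : Φ.natDegree = 5 := by
      simp only [Φ]; compute_degree!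
    have hz : Polynomial.aeval x Φ = 0 := by
      simp only [Φ, map_add, map_sub, map_mul, map_pow, Polynomial.aeval_X,
        hH, hF, map_intCast, map_ofNat]
      linear_combination hxm
    have hmp : Φ = minpoly ℚ x :=
      Polynomial.eq_of_monic_of_dvd_of_natDegree_le (minpoly.monic (Algebra.IsIntegral.isIntegral x)) hm
        (minpoly.dvd ℚ x hz) (by rw [hn, hd5])
    have hfr : finrank ℚ (IntermediateField.adjoin ℚ {x}) = 5 := by
      rw [IntermediateField.adjoin.finrank (Algebra.IsIntegral.isIntegral x), hd5]
    have hmul := Module.finrank_mul_finrank ℚ (IntermediateField.adjoin ℚ {x}) K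
    rw [hfr, Q.finrank_eq] at hmul
    have h1 : finrank (IntermediateField.adjoin ℚ {x}) K = 1 := by omega
    rw [Algebra.norm_eq_norm_adjoin, h1, pow_one]
    have hint : IsIntegral ℚ x := Algebra.IsIntegral.isIntegral x
    rw [← IntermediateField.adjoin.powerBasis_gen hint, Algebra.PowerBasis.norm_gen_eq_coeff_zero_minpoly,
      IntermediateField.adjoin.powerBasis_gen hint, IntermediateField.minpoly_gen, ← hmp,
      IntermediateField.adjoin.powerBasis_dim, hd5]
    simp [Φ]
    ring
  exact_mod_cast h1

end Quint

/-- Euler criterion value is `0` or `1`. -/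
def eul (p : ℕ) (a : ZMod p) : Bool := decide (a ^ ((p - 1) / 2) = 0 ∨ a ^ ((p - 1) / 2) = 1)

theorem eul_sq (p : ℕ) (hp2 : p ≠ 2) [hp : Fact p.Prime] (s : ZMod p) : eul p (s ^ 2) = true := by
  simp only [eul, decide_eq_true_eq]
  rw [← pow_mul, Nat.mul_div_cancel' ((hp.out.even_sub_one hp2).two_dvd)]
  by_cases h0 : s = 0
  · left; rw [h0, zero_pow]; have := hp.out.two_le; omega
  · right; exact ZMod.pow_card_sub_one_eq_one h0

/-- Norm of the product of the generators with exponents `e`. -/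
def ns (e0 e1 e2 e3 e4 e5 e6 e7 : ZMod 2) : ℤ :=
  nG 0 ^ e0.val * nG 1 ^ e1.val * nG 2 ^ e2.val * nG 3 ^ e3.val * nG 4 ^ e4.val * nG 5 ^ e5.val *
    nG 6 ^ e6.val * nG 7 ^ e7.val

/-- Local test for twice the norm being a square. -/
def nOK (e1 e2 e3 e4 e5 e6 e7 : ZMod 2) : Bool :=
  let n := 2 * ns 0 e1 e2 e3 e4 e5 e6 e7
  eul 7 n && eul 11 n && eul 13 n && eul 17 n

/-- The remaining exponent vectors. -/
def rem (e1 e2 e3 e4 e5 e6 e7 : ZMod 2) : Bool :=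
  decide ([e1, e2, e3, e4, e5, e6, e7] ∈ ([[0,0,0,0,1,0,0], [0,0,0,0,1,0,1], [0,1,1,0,0,0,0],
    [0,1,1,0,0,0,1], [1,0,1,1,1,1,0], [1,0,1,1,1,1,1], [1,1,0,1,0,1,0],
    [1,1,0,1,0,1,1]] : List (List (ZMod 2))))

theorem nOK_rem : ∀ e1 e2 e3 e4 e5 e6 e7 : ZMod 2,
    (!nOK e1 e2 e3 e4 e5 e6 e7 || rem e1 e2 e3 e4 e5 e6 e7) = true := by
  decide +kernel

/-- Local test at a root `r` of the quintic modulo `p`. -/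
def rt (p : ℕ) (r t : ZMod p) (x : Z5) (u v : ZMod p) : Bool :=
  eul p (hev (wl.map (Z5.ev r t)) u v * Z5.ev r t x)

/-- Local test for the value of `f`. -/
def ft (p : ℕ) (u v : ZMod p) : Bool := eul p (hev (fl.map (Int.cast : ℤ → ZMod p)) u v)

/-- Norm test over the quadratic extension of the field with 17 elements. -/
def qt (x : Z5) (u v : ZMod 17) : Bool :=
  let r : QuadraticAlgebra (ZMod 17) 16 7 := ⟨0, 1⟩
  eul 17 ((hev (wl.map (Z5.ev r ⟨9, 0⟩)) ⟨u, 0⟩ ⟨v, 0⟩ * Z5.ev r ⟨9, 0⟩ x).norm)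

instance fact_prime_7 : Fact (Nat.Prime 7) := ⟨by norm_num⟩

instance fact_prime_11 : Fact (Nat.Prime 11) := ⟨by norm_num⟩

instance fact_prime_13 : Fact (Nat.Prime 13) := ⟨by norm_num⟩

instance fact_prime_17 : Fact (Nat.Prime 17) := ⟨by norm_num⟩

instance fact_prime_31 : Fact (Nat.Prime 31) := ⟨by norm_num⟩

instance fact_prime_59 : Fact (Nat.Prime 59) := ⟨by norm_num⟩

theorem eul_scale (p : ℕ) (hp2 : p ≠ 2) [hp : Fact p.Prime] (c a : ZMod p) (hc : c ≠ 0)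
    (h : eul p a = true) : eul p (c ^ 2 * a) = true := by
  have h1 : (c ^ 2) ^ ((p - 1) / 2) = 1 := by
    rw [← pow_mul, Nat.mul_div_cancel' ((hp.out.even_sub_one hp2).two_dvd)]
    exact ZMod.pow_card_sub_one_eq_one hc
  simp only [eul, decide_eq_true_eq] at h ⊢
  rwa [mul_pow, h1, one_mul]

theorem hev_scale {F : Type*} [Field F] (l : List F) (k : ℕ) (hl : l.length = 2 * k + 1) (c u v : F)
    (hc : c ≠ 0) : hev l (c * u) (c * v) = (c ^ k) ^ 2 * hev l u v := by
  apply mul_right_cancel₀ hc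
  rw [hev_hom, hl]
  ring

theorem ft_scale (p : ℕ) (hp2 : p ≠ 2) [hp : Fact p.Prime] (c u v : ZMod p) (hc : c ≠ 0)
    (h : ft p u v = true) : ft p (c * u) (c * v) = true := by
  rw [ft, hev_scale _ 15 (by rw [List.length_map]; rfl) c u v hc]
  exact eul_scale p hp2 _ _ (pow_ne_zero _ hc) h

theorem rt_scale (p : ℕ) (hp2 : p ≠ 2) [hp : Fact p.Prime] (r t : ZMod p) (x : Z5) (c u v : ZMod p)
    (hc : c ≠ 0) (h : rt p r t x u v = true) : rt p r t x (c * u) (c * v) = true := by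
  rw [rt, hev_scale _ 3 (by rw [List.length_map]; rfl) c u v hc, mul_assoc]
  exact eul_scale p hp2 _ _ (pow_ne_zero _ hc) h

/-- It suffices to check the points of the projective line. -/
theorem kill_aff (p : ℕ) [hp : Fact p.Prime] (P : ZMod p → ZMod p → Bool)
    (hs : ∀ c u v, c ≠ 0 → P u v = true → P (c * u) (c * v) = true)
    (h1 : ∀ t, P t 1 = false) (h0 : P 1 0 = false) (u v : ZMod p) :
    (decide (u = 0 ∧ v = 0) || !P u v) = true := by
  simp only [Bool.or_eq_true, decide_eq_true_eq, Bool.not_eq_true']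
  by_contra! h
  have hP : P u v = true := by simpa using h.2
  by_cases hv : v = 0
  · have hu : u ≠ 0 := fun hu => h.1 hu hv
    have := hs u⁻¹ u v (inv_ne_zero hu) hP
    rw [inv_mul_cancel₀ hu, hv, mul_zero, h0] at this
    exact absurd this (by decide)
  · have := hs v⁻¹ u v (inv_ne_zero hv) hP
    rw [inv_mul_cancel₀ hv, h1] at this
    exact absurd this (by decide)

theorem kill13 : ∀ u v : ZMod 13, (decide (u = 0 ∧ v = 0) || !(ft 13 u v &&
    rt 13 3 7 (xs 0 0 0 0 0 1 0 1) u v && rt 13 5 7 (xs 0 0 0 0 0 1 0 1) u v &&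
    rt 13 7 7 (xs 0 0 0 0 0 1 0 1) u v)) = true := by
  decide +kernel

theorem kill59_t : ∀ t : ZMod 59, (ft 59 t 1 &&
    rt 59 34 30 (xs 0 0 1 1 0 0 0 0) t 1 && rt 59 46 30 (xs 0 0 1 1 0 0 0 0) t 1) = false := by
  decide +kernel

theorem kill59 (u v : ZMod 59) : (decide (u = 0 ∧ v = 0) || !(ft 59 u v &&
    rt 59 34 30 (xs 0 0 1 1 0 0 0 0) u v && rt 59 46 30 (xs 0 0 1 1 0 0 0 0) u v)) = true := by
  refine kill_aff 59 (fun u v => ft 59 u v && rt 59 34 30 (xs 0 0 1 1 0 0 0 0) u v &&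
    rt 59 46 30 (xs 0 0 1 1 0 0 0 0) u v) ?_ kill59_t (by decide +kernel) u v
  intro c u v hc h
  simp only [Bool.and_eq_true] at h ⊢
  exact ⟨⟨ft_scale 59 (by norm_num) _ _ _ hc h.1.1, rt_scale 59 (by norm_num) _ _ _ _ _ _ hc h.1.2⟩,
    rt_scale 59 (by norm_num) _ _ _ _ _ _ hc h.2⟩

theorem kill31_t : ∀ x ∈ [xs 0 1 0 1 1 1 1 0, xs 0 1 1 0 1 0 1 1], ∀ t : ZMod 31,
    (ft 31 t 1 && rt 31 16 16 x t 1 && rt 31 28 16 x t 1) = false := by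
  decide +kernel

theorem kill31_i : ∀ x ∈ [xs 0 1 0 1 1 1 1 0, xs 0 1 1 0 1 0 1 1],
    (ft 31 1 0 && rt 31 16 16 x 1 0 && rt 31 28 16 x 1 0) = false := by
  decide +kernel

theorem kill31 (u v : ZMod 31) (x : Z5) (hx : x ∈ [xs 0 1 0 1 1 1 1 0, xs 0 1 1 0 1 0 1 1]) :
    (decide (u = 0 ∧ v = 0) || !(ft 31 u v && rt 31 16 16 x u v && rt 31 28 16 x u v)) = true := by
  refine kill_aff 31 (fun u v => ft 31 u v && rt 31 16 16 x u v && rt 31 28 16 x u v) ?_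
    (kill31_t x hx) (kill31_i x hx) u v
  intro c u v hc h
  simp only [Bool.and_eq_true] at h ⊢
  exact ⟨⟨ft_scale 31 (by norm_num) _ _ _ hc h.1.1, rt_scale 31 (by norm_num) _ _ _ _ _ _ hc h.1.2⟩,
    rt_scale 31 (by norm_num) _ _ _ _ _ _ hc h.2⟩

theorem kill17 : ∀ u v : ZMod 17,
    ∀ x ∈ [xs 0 0 0 0 0 1 0 0, xs 0 0 1 1 0 0 0 1, xs 0 1 0 1 1 1 1 1, xs 0 1 1 0 1 0 1 0],
    (decide (u = 0 ∧ v = 0) || !(ft 17 u v && qt x u v)) = true := by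
  decide +kernel

namespace Quint

variable {K : Type*} [Field K] [NumberField K] (Q : Quint K)

theorem norm_xs (e0 e1 e2 e3 e4 e5 e6 e7 : ZMod 2) :
    Algebra.norm ℤ (Q.el (xs e0 e1 e2 e3 e4 e5 e6 e7)) = ns e0 e1 e2 e3 e4 e5 e6 e7 := by
  have h : ∀ i, Algebra.norm ℤ (Q.el (xG i)) = nG i := fun i => Q.norm_val _ _ (xG_nrm i)
  simp only [xs, el_mul, el_pw, map_mul, map_pow, h, ns]

theorem norm_filter (u v y : ℤ) (h : IsCoprime u v) (hy : y ^ 2 = hev fl u v)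
    (e1 e2 e3 e4 e5 e6 e7 : ZMod 2) (z : 𝓞 K)
    (hz : Q.w u v * Q.el (xs 0 e1 e2 e3 e4 e5 e6 e7) = z ^ 2) : nOK e1 e2 e3 e4 e5 e6 e7 = true := by
  have h1 := congrArg (Algebra.norm ℤ) hz
  rw [map_mul, Q.norm_w u v h, norm_xs, map_pow, ← hy] at h1
  have hy0 : y ≠ 0 := by
    rintro rfl
    exact f_ne u v h (by rw [← hy]; norm_num)
  have h2 : (18 * y) ^ 2 * (2 * ns 0 e1 e2 e3 e4 e5 e6 e7) = Algebra.norm ℤ z ^ 2 := by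
    rw [← h1]; ring
  have h3 : 18 * y ∣ Algebra.norm ℤ z := (Int.pow_dvd_pow_iff two_ne_zero).1 ⟨_, h2.symm⟩
  obtain ⟨m, hm⟩ := h3
  have h4 : 2 * ns 0 e1 e2 e3 e4 e5 e6 e7 = m ^ 2 := by
    have h5 : (18 * y) ^ 2 ≠ 0 := pow_ne_zero _ (mul_ne_zero (by norm_num) hy0)
    apply mul_left_cancel₀ h5
    rw [h2, hm]; ring
  simp only [nOK, h4, Int.cast_pow, Bool.and_eq_true]
  exact ⟨⟨⟨eul_sq 7 (by norm_num) _, eul_sq 11 (by norm_num) _⟩, eul_sq 13 (by norm_num) _⟩,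
    eul_sq 17 (by norm_num) _⟩

theorem ft_of (_ : Quint K) (u v y : ℤ) (hy : y ^ 2 = hev fl u v) (p : ℕ) (hp2 : p ≠ 2) [Fact p.Prime] :
    ft p u v = true := by
  rw [ft, ← hev_zmod, ← hy, Int.cast_pow]
  exact eul_sq p hp2 _

theorem rt_of (p : ℕ) (r t c : ZMod p) (hp2 : p ≠ 2) (ht : 2 * t = 1)
    (hr : r ^ 5 = 5 * r ^ 4 + 20 * r ^ 3 + 20 * r ^ 2 + 20 * r + 20)
    (hc : c * 16200000 = 1) [hp : Fact p.Prime] (x : Z5) (u v : ℤ) (z : 𝓞 K)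
    (hz : Q.w u v * Q.el x = z ^ 2) : rt p r t x u v = true := by
  obtain ⟨s, hs⟩ := Q.sq_ev r t c ht hr hc ((zev wl u v).mul x) z (by rw [el_mul]; exact hz)
  rw [Z5.ev_mul r t ht hr, ev_zev] at hs
  rw [rt, hs]
  exact eul_sq p hp2 _

theorem qt_of (x : Z5) (u v : ℤ) (z : 𝓞 K)
    (hz : Q.w u v * Q.el x = z ^ 2) : qt x u v = true := by
  have ht : (2 : QuadraticAlgebra (ZMod 17) 16 7) * ⟨9, 0⟩ = 1 := by decide +kernel
  have hr : (⟨0, 1⟩ : QuadraticAlgebra (ZMod 17) 16 7) ^ 5 = 5 * ⟨0, 1⟩ ^ 4 + 20 * ⟨0, 1⟩ ^ 3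
    + 20 * ⟨0, 1⟩ ^ 2 + 20 * ⟨0, 1⟩ + 20 := by decide +kernel
  have hc : ∃ c : ZMod 17, (⟨c, 0⟩ : QuadraticAlgebra (ZMod 17) 16 7) * 16200000 = 1 := by
    decide +kernel
  obtain ⟨c, hc⟩ := hc
  obtain ⟨s, hs⟩ := Q.sq_ev _ _ _ ht hr hc ((zev wl u v).mul x) z (by rw [el_mul]; exact hz)
  rw [Z5.ev_mul _ _ ht hr, ev_zev] at hs
  have e : ∀ n : ℤ, ((n : ℤ) : QuadraticAlgebra (ZMod 17) 16 7) = ⟨(n : ZMod 17), 0⟩ := by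
    intro n; ext <;> simp
  rw [e, e] at hs
  simp only [qt]
  rw [hs, map_pow]
  exact eul_sq 17 (by norm_num) _

theorem no_points (Q : Quint K) (u v y : ℤ) (h : IsCoprime u v) : y ^ 2 ≠ hev fl u v := by
  intro hy
  obtain ⟨e0, e1, e2, e3, e4, e5, e6, e7, z, hz⟩ :=
    Q.descent (Q.w u v) (Q.w_ne u v h) (Q.w_even u v y h hy)
  obtain rfl := Q.e0_zero u v y h hy e0 e1 e2 e3 e4 e5 e6 e7 z hz
  have h1 := Q.norm_filter u v y h hy e1 e2 e3 e4 e5 e6 e7 z hz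
  have h2 := nOK_rem e1 e2 e3 e4 e5 e6 e7
  rw [h1] at h2
  simp only [Bool.not_true, Bool.false_or, rem, decide_eq_true_eq, List.mem_cons, List.cons.injEq,
    and_true, List.not_mem_nil, or_false] at h2
  have c13 := cop_mod u v h 13 (by norm_num)
  have c17 := cop_mod u v h 17 (by norm_num)
  have c31 := cop_mod u v h 31 (by norm_num)
  have c59 := cop_mod u v h 59 (by norm_num)
  have k17 : ∀ x ∈ [xs 0 0 0 0 0 1 0 0, xs 0 0 1 1 0 0 0 1, xs 0 1 0 1 1 1 1 1, xs 0 1 1 0 1 0 1 0],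
      Q.w u v * Q.el x = z ^ 2 → False := by
    intro x hx hz
    have := kill17 u v x hx
    rw [Q.ft_of u v y hy 17 (by norm_num), Q.qt_of x u v z hz, decide_eq_false c17] at this
    exact absurd this (by decide)
  have k31 : ∀ x ∈ [xs 0 1 0 1 1 1 1 0, xs 0 1 1 0 1 0 1 1], Q.w u v * Q.el x = z ^ 2 → False := by
    intro x hx hz
    have := kill31 u v x hx
    have hc : ∃ c : ZMod 31, c * 16200000 = 1 := by decide +kernel
    obtain ⟨c, hc⟩ := hc
    rw [Q.ft_of u v y hy 31 (by norm_num), decide_eq_false c31,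
      Q.rt_of 31 16 16 c (by norm_num) (by decide +kernel) (by decide +kernel) hc x u v z hz,
      Q.rt_of 31 28 16 c (by norm_num) (by decide +kernel) (by decide +kernel) hc x u v z hz] at this
    exact absurd this (by decide)
  rcases h2 with ⟨rfl, rfl, rfl, rfl, rfl, rfl, rfl⟩ | ⟨rfl, rfl, rfl, rfl, rfl, rfl, rfl⟩ |
    ⟨rfl, rfl, rfl, rfl, rfl, rfl, rfl⟩ | ⟨rfl, rfl, rfl, rfl, rfl, rfl, rfl⟩ |
    ⟨rfl, rfl, rfl, rfl, rfl, rfl, rfl⟩ | ⟨rfl, rfl, rfl, rfl, rfl, rfl, rfl⟩ |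
    ⟨rfl, rfl, rfl, rfl, rfl, rfl, rfl⟩ | ⟨rfl, rfl, rfl, rfl, rfl, rfl, rfl⟩
  · exact k17 _ (.head _) hz
  · have := kill13 u v
    have hc : ∃ c : ZMod 13, c * 16200000 = 1 := by decide +kernel
    obtain ⟨c, hc⟩ := hc
    rw [Q.ft_of u v y hy 13 (by norm_num), decide_eq_false c13,
      Q.rt_of 13 3 7 c (by norm_num) (by decide +kernel) (by decide +kernel) hc _ u v z hz,
      Q.rt_of 13 5 7 c (by norm_num) (by decide +kernel) (by decide +kernel) hc _ u v z hz,
      Q.rt_of 13 7 7 c (by norm_num) (by decide +kernel) (by decide +kernel) hc _ u v z hz] at this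
    exact absurd this (by decide)
  · have := kill59 u v
    have hc : ∃ c : ZMod 59, c * 16200000 = 1 := by decide +kernel
    obtain ⟨c, hc⟩ := hc
    rw [Q.ft_of u v y hy 59 (by norm_num), decide_eq_false c59,
      Q.rt_of 59 34 30 c (by norm_num) (by decide +kernel) (by decide +kernel) hc _ u v z hz,
      Q.rt_of 59 46 30 c (by norm_num) (by decide +kernel) (by decide +kernel) hc _ u v z hz] at this
    exact absurd this (by decide)
  · exact k17 _ (.tail _ (.head _)) hz
  · exact k31 _ (.head _) hz
  · exact k17 _ (.tail _ (.tail _ (.head _))) hz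
  · exact k17 _ (.tail _ (.tail _ (.tail _ (.head _)))) hz
  · exact k31 _ (.tail _ (.head _)) hz

end Quint

/-- The defining quintic over the integers. -/
noncomputable def qZ : Polynomial ℤ :=
  Polynomial.X ^ 5 - 5 * Polynomial.X ^ 4 - 20 * Polynomial.X ^ 3 - 20 * Polynomial.X ^ 2
    - 20 * Polynomial.X - 20

theorem qZ_natDegree : qZ.natDegree = 5 := by
  unfold qZ; compute_degree!

theorem qZ_monic : qZ.Monic := by
  unfold qZ; monicity!

theorem qZ_irr : Irreducible qZ := by
  have hp : (Ideal.span {(5 : ℤ)}).IsPrime :=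
    (Ideal.span_singleton_prime (by norm_num)).2 (by norm_num [Int.prime_iff_natAbs_prime])
  refine Polynomial.IsEisensteinAt.irreducible (𝓟 := Ideal.span {(5 : ℤ)}) ⟨?_, ?_, ?_⟩ hp
    qZ_monic.isPrimitive (by rw [qZ_natDegree]; norm_num)
  · rw [qZ_monic.leadingCoeff, Ideal.mem_span_singleton]; norm_num
  · intro n hn
    rw [qZ_natDegree] at hn
    rw [Ideal.mem_span_singleton, qZ]
    interval_cases n <;> simp [Polynomial.coeff_X, Polynomial.coeff_ofNat_mul, Polynomial.coeff_X_pow]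
  · rw [Ideal.span_singleton_pow, Ideal.mem_span_singleton, qZ]
    simp

/-- The defining quintic over the rationals. -/
noncomputable def qQ : Polynomial ℚ := qZ.map (algebraMap ℤ ℚ)

theorem qQ_irr : Irreducible qQ :=
  (Polynomial.Monic.irreducible_iff_irreducible_map_fraction_map qZ_monic).1 qZ_irr

theorem qQ_eval {R : Type*} [CommRing R] (φ : ℚ →+* R) (r : R) :
    qQ.eval₂ φ r = r ^ 5 - 5 * r ^ 4 - 20 * r ^ 3 - 20 * r ^ 2 - 20 * r - 20 := by
  simp [qQ, qZ, Polynomial.eval₂_sub, Polynomial.eval₂_mul, Polynomial.eval₂_pow]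

theorem exists_quint : ∃ (K : Type) (_ : Field K) (_ : NumberField K), Nonempty (Quint K) := by
  have : Fact (Irreducible qQ) := ⟨qQ_irr⟩
  have h0 : qQ ≠ 0 := qQ_irr.ne_zero
  let pb := AdjoinRoot.powerBasis h0
  have : FiniteDimensional ℚ (AdjoinRoot qQ) := pb.finite
  have : CharZero (AdjoinRoot qQ) := charZero_of_injective_algebraMap (algebraMap ℚ (AdjoinRoot qQ)).injective
  have : NumberField (AdjoinRoot qQ) := ⟨⟩
  refine ⟨AdjoinRoot qQ, inferInstance, inferInstance, ⟨⟨pb, ?_, ?_⟩⟩⟩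
  · rw [AdjoinRoot.powerBasis_dim, qQ, qZ_monic.natDegree_map, qZ_natDegree]
  · have h := AdjoinRoot.eval₂_root qQ
    rw [qQ_eval] at h
    rw [AdjoinRoot.powerBasis_gen]
    linear_combination h

theorem no_coprime (u v y : ℤ) (h : IsCoprime u v) : y ^ 2 ≠ hev fl u v := by
  obtain ⟨K, _, _, ⟨Q⟩⟩ := exists_quint
  exact Q.no_points u v y h

theorem no_integral (u v y : ℤ) (h : ¬ (u = 0 ∧ v = 0)) : y ^ 2 ≠ hev fl u v := by
  intro hy
  have hg : Int.gcd u v ≠ 0 := by rwa [Ne, Int.gcd_eq_zero_iff]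
  obtain ⟨a, b, hab, hu, hv⟩ := Int.exists_gcd_one (Nat.pos_of_ne_zero hg)
  set d : ℤ := (Int.gcd u v : ℤ)
  have hd : d ≠ 0 := Int.natCast_ne_zero.2 hg
  have h1 := hev_hom fl d a b
  rw [mul_comm d a, mul_comm d b, ← hu, ← hv, ← hy, show fl.length = 31 from rfl] at h1
  have h2 : y ^ 2 = (d ^ 15) ^ 2 * hev fl a b := by
    apply mul_right_cancel₀ hd
    rw [h1]; ring
  obtain ⟨m, rfl⟩ := (Int.pow_dvd_pow_iff two_ne_zero).1 (Dvd.intro _ h2.symm)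
  refine no_coprime a b m (Int.isCoprime_iff_gcd_eq_one.2 hab) ?_
  apply mul_left_cancel₀ (pow_ne_zero 2 (pow_ne_zero 15 hd))
  rw [← h2]; ring

end Field

/-- Coefficients of the derivative with respect to `u`; `k` is the exponent of the head. -/
def duL (k : ℤ) : List ℤ → List ℤ
  | [] => []
  | a :: l => k * a :: duL (k + 1) l

/-- Coefficients of the derivative with respect to `v`. -/
def dvL : List ℤ → List ℤ
  | [] => []
  | [_] => []
  | a :: b :: l => (l.length + 1 : ℤ) * a :: dvL (b :: l)

/-- The binary form with integer coefficients `l`, over the rationals. -/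
noncomputable def bf (l : List ℤ) : MvPolynomial (Fin 2) ℚ :=
  hev (l.map fun n : ℤ => C (n : ℚ)) (X 0) (X 1)

theorem bf_cons (a : ℤ) (l : List ℤ) : bf (a :: l) = C (a : ℚ) * X 1 ^ l.length + X 0 * bf l := by
  simp [bf, hev]

theorem length_duL (l : List ℤ) : ∀ k, (duL k l).length = l.length := by
  induction l with
  | nil => intro k; rfl
  | cons a l ih => intro k; simp [duL, ih]

theorem length_dvL (l : List ℤ) : (dvL l).length = l.length - 1 := by
  induction l with
  | nil => rfl
  | cons a l ih =>
    cases l with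
    | nil => rfl
    | cons b l => simp [dvL] at ih ⊢; exact ih

theorem pd0_aux (l : List ℤ) : ∀ k : ℤ, bf (duL k l) = C (k : ℚ) * bf l + X 0 * pderiv 0 (bf l) := by
  induction l with
  | nil => intro k; simp [bf, hev, duL]
  | cons a l ih =>
    intro k
    rw [duL, bf_cons, bf_cons, ih, length_duL]
    simp only [map_add, Derivation.leibniz, Derivation.leibniz_pow, pderiv_X_self, pderiv_C,
      pderiv_X_of_ne (show (1 : Fin 2) ≠ 0 by decide), smul_eq_mul, Int.cast_add, Int.cast_mul, Int.cast_one,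
      map_mul, map_one]
    simp
    ring

theorem pd0 (a : ℤ) (l : List ℤ) : pderiv 0 (bf (a :: l)) = bf (duL 1 l) := by
  rw [pd0_aux, bf_cons]
  simp only [map_add, Derivation.leibniz, Derivation.leibniz_pow, pderiv_X_self, pderiv_C,
      pderiv_X_of_ne (show (1 : Fin 2) ≠ 0 by decide), smul_eq_mul, Int.cast_one, map_one]
  simp
  ring

theorem pd1 (l : List ℤ) : pderiv 1 (bf l) = bf (dvL l) := by
  induction l with
  | nil => simp [bf, hev, dvL]
  | cons a l ih =>
    cases l with
    | nil => simp [bf, hev, dvL]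
    | cons b l =>
      rw [dvL, bf_cons, bf_cons _ (dvL _), map_add, Derivation.leibniz _ (X 0), ih, length_dvL]
      simp only [Derivation.leibniz, Derivation.leibniz_pow, pderiv_X_self, pderiv_C,
        pderiv_X_of_ne (show (0 : Fin 2) ≠ 1 by decide), smul_eq_mul]
      simp
      ring

theorem h_coeff : ∀ i : Fin 13, (Nat.choose 12 i : ℚ) * alphaC15 i = ((hl.getD i 0 : ℤ) : ℚ) := by
  intro i
  fin_cases i <;> norm_num [alphaC15, hl, Nat.choose]

theorem hC15_eq : hC15 = bf hl := by
  have h : hC15 = ∑ i ∈ Finset.range 13, C ((hl.getD i 0 : ℤ) : ℚ) * X 0 ^ i * X 1 ^ (12 - i) := by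
    rw [hC15, ← Fin.sum_univ_eq_sum_range
      (fun i => (C ((hl.getD i 0 : ℤ) : ℚ) * X 0 ^ i * X 1 ^ (12 - i) : MvPolynomial (Fin 2) ℚ)) 13]
    exact Finset.sum_congr rfl fun i _ => by rw [h_coeff]
  rw [h]
  simp only [Finset.sum_range_succ, Finset.sum_range_zero, hl, bf_cons, List.length_cons,
    List.length_nil, List.getD_cons_zero, List.getD_cons_succ, show bf [] = 0 from rfl]
  ring

theorem bf_mulL (l m : List ℤ) (hm : m ≠ []) : bf (mulL l m) = bf l * bf m := by
  rw [bf, map_mulL (fun n : ℤ => (C (n : ℚ) : MvPolynomial (Fin 2) ℚ)) (by simp) (by simp) (by simp),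
    hev_mulL _ _ _ _ (by simpa using hm)]
  rfl

theorem bf_addL (l m : List ℤ) (h : l.length = m.length) : bf (addL l m) = bf l + bf m := by
  rw [bf, map_addL (fun n : ℤ => (C (n : ℚ) : MvPolynomial (Fin 2) ℚ)) (by simp),
    hev_addL _ _ _ _ (by simpa using h)]
  rfl

theorem bf_smul (l : List ℤ) (k : ℤ) : bf (l.map (k * ·)) = C (k : ℚ) * bf l := by
  rw [bf, bf, ← hev_map_mul]
  simp [Function.comp_def]

/-- Coefficients of the first derivative of `h`. -/
def hu : List ℤ := duL 1 hl.tail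
/-- Coefficients of the second derivative of `h`. -/
def huu : List ℤ := duL 1 hu.tail

theorem g_list : addL (mulL huu (dvL (dvL hl))) ((mulL (dvL hu) (dvL hu)).map (-1 * ·)) =
    gl.map (132 ^ 2 * ·) := by
  decide +kernel

theorem f_list : addL (mulL hu (dvL gl)) ((mulL (dvL hl) (duL 1 gl.tail)).map (-1 * ·)) =
    fl.map (240 * ·) := by
  decide +kernel

theorem h_u : pderiv 0 (bf hl) = bf hu := pd0 _ _
theorem h_uu : pderiv 0 (bf hu) = bf huu := pd0 _ _
theorem g_u : pderiv 0 (bf gl) = bf (duL 1 gl.tail) := pd0 _ _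

theorem gC15_eq : gC15 = bf gl := by
  have h := congrArg bf g_list
  rw [bf_addL _ _ (by decide), bf_smul, bf_smul, bf_mulL _ _ (by decide), bf_mulL _ _ (by decide)] at h
  rw [gC15, hC15_eq, h_u, h_uu, pd1, pd1, pd1]
  have e : bf huu * bf (dvL (dvL hl)) - bf (dvL hu) * bf (dvL hu) = C ((132 ^ 2 : ℤ) : ℚ) * bf gl := by
    rw [← h]; simp; ring
  rw [e, ← mul_assoc, ← C_mul]
  norm_num

theorem fC15_eq : fC15 = bf fl := by
  have h := congrArg bf f_list
  rw [bf_addL _ _ (by decide), bf_smul, bf_smul, bf_mulL _ _ (by decide), bf_mulL _ _ (by decide)] at h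
  rw [fC15, gC15_eq, hC15_eq, h_u, g_u, pd1, pd1]
  have e : bf hu * bf (dvL gl) - bf (dvL hl) * bf (duL 1 gl.tail) = C ((240 : ℤ) : ℚ) * bf fl := by
    rw [← h]; simp; ring
  rw [e, ← mul_assoc, ← C_mul]
  norm_num

theorem bf_hom (l : List ℤ) : (bf l).IsHomogeneous (l.length - 1) := by
  induction l with
  | nil => simpa [bf, hev] using isHomogeneous_zero _ _ _
  | cons a l ih =>
    rw [bf_cons]
    have h1 : (C (a : ℚ) * X 1 ^ l.length : MvPolynomial (Fin 2) ℚ).IsHomogeneous l.length := by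
      have := (isHomogeneous_C (Fin 2) (a : ℚ)).mul ((isHomogeneous_X ℚ (1 : Fin 2)).pow l.length)
      simpa using this
    refine h1.add ?_
    cases l with
    | nil => simpa [bf, hev] using isHomogeneous_zero _ _ _
    | cons b l =>
      have := (isHomogeneous_X ℚ (0 : Fin 2)).mul ih
      simpa [add_comm] using this

theorem bf_map (l : List ℤ) :
    bf l = map (Int.castRingHom ℚ) (hev (l.map fun n => (C n : MvPolynomial (Fin 2) ℤ)) (X 0) (X 1)) := by
  rw [← hev_map]
  simp [bf, Function.comp_def]

theorem bf_eval (l : List ℤ) (u v : ℤ) :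
    eval ![(u : ℚ), (v : ℚ)] (bf l) = ((hev l u v : ℤ) : ℚ) := by
  rw [bf, ← hev_map, ← eq_intCast (Int.castRingHom ℚ) (hev l u v), ← hev_map]
  simp [Function.comp_def]

/-- The form `f` is homogeneous of degree 30 with integer coefficients, and the
genus-14 hyperelliptic curve `C_15 : y² = f(u,v)` has no rational points. -/
theorem rational_points_C15 :
    fC15.IsHomogeneous 30 ∧
    (∀ m : Fin 2 →₀ ℕ, ∃ z : ℤ, coeff m fC15 = (z : ℚ)) ∧
    ¬ ∃ u v y : ℤ, (u, v) ≠ (0, 0) ∧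
        (y : ℚ) ^ 2 = eval ![(u : ℚ), (v : ℚ)] fC15 := by
  rw [fC15_eq]
  refine ⟨bf_hom fl, fun m => ?_, ?_⟩
  · exact ⟨_, by rw [bf_map, coeff_map]; rfl⟩
  · rintro ⟨u, v, y, h, hy⟩
    rw [bf_eval] at hy
    exact no_integral u v y (by simpa using h) (by exact_mod_cast hy)
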